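/- Assume the partition setup for R, W, V_1, …, V_s, W_1, …, W_s, U_1, …, U_s, with integers t ≥ 2, k ≥ 3 and k ≤ s ≤ t+k. Let K = 2.4·10^7·(t+k)^5, let m be an even integer with m ≥ 1.728·10^10·(t+k)^9, suppose R contains no cycle of length m, suppose |V| ≤ (t+k)·m, and suppose 2·δ(R) > m + K + 2s. Then Σ_{i=1}^{s} |U_i| ≤ |V| + s − 1. -/

import Mathlib

/-- `G` contains a cycle of length `m`. -/
def HasCycleLen {V : Type*} (G : SimpleGraph V) (m : ℕ) : Prop :=
  ∃ (v : V) (c : G.Walk v v), c.IsCycle ∧ c.length = m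

/-- The subgraph of `R` induced by the finite vertex set `A` is 2-connected:
it has at least 3 vertices, is connected, and remains connected after deleting
any one vertex. -/
def TwoConnectedOn {V : Type*} [DecidableEq V] (R : SimpleGraph V) (A : Finset V) : Prop :=
  3 ≤ A.card ∧ (R.induce (A : Set V)).Connected ∧
    ∀ v ∈ A, (R.induce ((A.erase v : Finset V) : Set V)).Connected

/-- `W_i`: the vertices of `W` having at least `2s` neighbours (in `R`) inside `A`. -/
def bigNbrSet {V : Type*} [DecidableEq V] (R : SimpleGraph V) [DecidableRel R.Adj]
    (s : ℕ) (W A : Finset V) : Finset V :=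
  W.filter fun w => 2 * s ≤ (A.filter fun v => R.Adj w v).card



section Part1
variable {V : Type*} {R : SimpleGraph V}

def Cyc (R : SimpleGraph V) (l : List V) : Prop :=
  3 ≤ l.length ∧ l.Nodup ∧ List.IsChain R.Adj (l ++ l.take 1)

lemma Cyc.hasCycleLen {l : List V} (h : Cyc R l) : HasCycleLen R l.length := by
  obtain ⟨h3, hnd, hc⟩ := h
  have hne : l ≠ [] := by rintro rfl; simp at h3
  have hc1 : l.IsChain R.Adj := hc.left_of_append
  let p := SimpleGraph.Walk.ofSupport l hne hc1
  have hps : p.support = l := SimpleGraph.Walk.support_ofSupport ..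
  have hpp : p.IsPath := by rw [SimpleGraph.Walk.isPath_def, hps]; exact hnd
  have hlen : p.length = l.length - 1 := SimpleGraph.Walk.length_ofSupport ..
  have hadj : R.Adj (l.getLast hne) (l.head hne) := by
    rw [List.isChain_append] at hc
    obtain ⟨_, _, h⟩ := hc
    refine h _ (List.getLast_mem_getLast? hne) _ ?_
    cases l with
    | nil => simp at hne
    | cons a l => simp
  refine ⟨_, SimpleGraph.Walk.cons hadj p, ?_, ?_⟩
  · rw [SimpleGraph.Walk.cons_isCycle_iff]
    refine ⟨hpp, fun he => ?_⟩
    rw [Sym2.eq_swap] at he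
    have := hpp.length_eq_one_of_mem_edges he
    omega
  · simp [hlen]; omega

end Part1


section Part2
variable {V : Type*} {R : SimpleGraph V}

lemma pair_infix_append {p q : V} {L1 L2 : List V} (h : [p,q] <:+: L1 ++ L2) :
    [p,q] <:+: L1 ∨ [p,q] <:+: L2 ∨ (∃ s t, L1 = s ++ [p] ∧ L2 = q :: t) := by
  obtain ⟨s, t, h⟩ := h
  rw [List.append_assoc, List.append_eq_append_iff] at h
  rcases h with ⟨as, h1, h2⟩ | ⟨bs, h1, h2⟩
  · rcases as with _ | ⟨a, as⟩
    · right; left; exact ⟨[], t, by simpa using h2⟩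
    · rcases as with _ | ⟨b, as⟩
      · right; right
        simp at h2
        refine ⟨s, t, ?_, h2.2.symm⟩
        rw [h1, h2.1]
      · left
        simp at h2
        obtain ⟨rfl, rfl, h2⟩ := h2
        exact ⟨s, as, by simp [h1]⟩
  · right; left
    exact ⟨bs, t, by simp [h2]⟩

lemma pair_preserve {F : Finset V} {A Z E : List V} {p q : V} (hp : p ∈ F) (hq : q ∈ F)
    (hZ : ∀ v ∈ Z, v ∉ F) (hne : Z ≠ []) (h : [p,q] <:+: A ++ (Z ++ E)) :
    [p,q] <:+: A ∨ [p,q] <:+: E := by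
  obtain ⟨z, Z', rfl⟩ := List.exists_cons_of_ne_nil hne
  rcases pair_infix_append h with h | h | ⟨s, t, h1, h2⟩
  · exact Or.inl h
  · rcases pair_infix_append h with h | h | ⟨s, t, h1, h2⟩
    · exact absurd hp (hZ _ (h.subset (by simp)))
    · exact Or.inr h
    · exact absurd hp (hZ _ (by rw [h1]; simp))
  · simp at h2
    exact absurd hq (hZ _ (by simp [h2.1]))

lemma Cyc.replace {A Z Z' E : List V} (h : Cyc R (A ++ (Z ++ E))) (hh : Z.head? = Z'.head?)
    (hl : Z.getLast? = Z'.getLast?) (hne : Z' ≠ []) (hc : Z'.IsChain R.Adj) (hnd : Z'.Nodup)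
    (hA : ∀ v ∈ Z', v ∉ A) (hE : ∀ v ∈ Z', v ∉ E) (h3 : 3 ≤ (A ++ (Z' ++ E)).length) :
    Cyc R (A ++ (Z' ++ E)) := by
  obtain ⟨_, h2, hch⟩ := h
  refine ⟨h3, ?_, ?_⟩
  · simp only [List.nodup_append] at h2 ⊢
    obtain ⟨a1, ⟨a2, a3, a4⟩, a5⟩ := h2
    refine ⟨a1, ⟨hnd, a3, ?_⟩, ?_⟩
    · rintro a ha b hb rfl; exact hE _ ha hb
    · rintro a ha b hb rfl
      rcases List.mem_append.1 hb with hb | hb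
      · exact hA _ hb ha
      · exact a5 a ha a (by simp [hb]) rfl
  · obtain ⟨z, Y, rfl⟩ := List.exists_cons_of_ne_nil hne
    have hZ : Z ≠ [] := by rintro rfl; simp at hh
    obtain ⟨y, Y', rfl⟩ := List.exists_cons_of_ne_nil hZ
    simp at hh
    subst hh
    have ht : (A ++ (y :: Y' ++ E)).take 1 = (A ++ (y :: Y ++ E)).take 1 := by
      cases A <;> simp
    rw [ht] at hch
    generalize (A ++ (y :: Y ++ E)).take 1 = T at *
    simp only [List.append_assoc] at hch ⊢
    rw [List.isChain_append, List.isChain_append] at hch ⊢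
    obtain ⟨b1, ⟨b2, b3, b4⟩, b5⟩ := hch
    refine ⟨b1, ⟨hc, b3, ?_⟩, ?_⟩
    · rw [← hl]; exact b4
    · simpa using b5

def Flex (R : SimpleGraph V) (F : Finset V) (f : ℕ) (l : List V) : Prop :=
  Cyc R l ∧ ∀ l', Cyc R l' →
    (∀ p ∈ F, ∀ q ∈ F, [p,q] <:+: l → [p,q] <:+: l' ∨ [q,p] <:+: l') →
    (∀ v ∈ F, v ∈ l' → v ∈ l) → ∀ j ≤ f, ∃ l'', Cyc R l'' ∧ l''.length = l'.length + 2 * j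

lemma Flex.self {F : Finset V} {f : ℕ} {l : List V} (h : Flex R F f l) {j : ℕ} (hj : j ≤ f) :
    ∃ l'', Cyc R l'' ∧ l''.length = l.length + 2 * j :=
  h.2 l h.1 (fun _ _ _ _ h => Or.inl h) (fun _ _ h => h) j hj

lemma Flex.base {l : List V} (h : Cyc R l) : Flex R ∅ 0 l :=
  ⟨h, fun l' hl' _ _ j hj => ⟨l', hl', by omega⟩⟩

lemma Flex.mv {F : Finset V} {f : ℕ} {l l1 : List V} (h : Flex R F f l) (h1 : Cyc R l1)
    (hp : ∀ p ∈ F, ∀ q ∈ F, [p,q] <:+: l → [p,q] <:+: l1 ∨ [q,p] <:+: l1)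
    (hm : ∀ v ∈ F, v ∈ l1 → v ∈ l) : Flex R F f l1 := by
  refine ⟨h1, fun l' hl' hp' hm' j hj => h.2 l' hl' ?_ ?_ j hj⟩
  · intro p hpF q hqF hpq
    rcases hp p hpF q hqF hpq with h | h
    · exact hp' p hpF q hqF h
    · exact (hp' q hqF p hpF h).symm
  · exact fun v hv hvl => hm v hv (hm' v hv hvl)

lemma pair_insert {F : Finset V} {a c x y p q : V} {A E : List V} (ha : a ∉ F) (hc : c ∉ F)
    (hp : p ∈ F) (hq : q ∈ F) (h : [p,q] <:+: A ++ ([a,c] ++ E)) :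
    [p,q] <:+: A ++ ([a,x,y,c] ++ E) := by
  have := pair_preserve hp hq (Z := [a,c]) (by simp [ha,hc]) (by simp) h
  rcases this with h | h
  · exact h.trans (List.prefix_append _ _).isInfix
  · exact h.trans ⟨A ++ [a,x,y,c], [], by simp⟩

lemma Flex.sw [DecidableEq V] {F : Finset V} {f : ℕ} {l : List V} (h : Flex R F f l)
    {a c x y : V} (hac : [a,c] <:+: l) (hx : x ∉ l) (hy : y ∉ l) (hxy : x ≠ y)
    (ha : a ∉ F) (hc : c ∉ F) (hxF : x ∉ F) (hyF : y ∉ F)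
    (h1 : R.Adj a x) (h2 : R.Adj x y) (h3 : R.Adj y c) :
    Flex R (F ∪ {a,c,x,y}) (f+1) l := by
  refine ⟨h.1, fun l' hl' hp hm j hj => ?_⟩
  have hp1 : ∀ p ∈ F, ∀ q ∈ F, [p,q] <:+: l → [p,q] <:+: l' ∨ [q,p] <:+: l' :=
    fun p hpF q hqF => hp p (by simp [hpF]) q (by simp [hqF])
  have hm1 : ∀ v ∈ F, v ∈ l' → v ∈ l := fun v hv => hm v (by simp [hv])
  rcases Nat.lt_or_ge f j with hj' | hj'
  swap
  · exact h.2 l' hl' hp1 hm1 j hj'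
  have hx' : x ∉ l' := fun hh => hx (hm x (by simp) hh)
  have hy' : y ∉ l' := fun hh => hy (hm y (by simp) hh)
  have key : ∃ l2, Cyc R l2 ∧ l2.length = l'.length + 2 ∧
      (∀ p ∈ F, ∀ q ∈ F, [p,q] <:+: l' → [p,q] <:+: l2) ∧ (∀ v ∈ F, v ∈ l2 → v ∈ l') := by
    have main : ∀ a c x y : V, [a,c] <:+: l' → x ∉ l' → y ∉ l' → x ≠ y → a ∉ F → c ∉ F →
        x ∉ F → y ∉ F → R.Adj a x → R.Adj x y → R.Adj y c → 
        ∃ l2, Cyc R l2 ∧ l2.length = l'.length + 2 ∧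
      (∀ p ∈ F, ∀ q ∈ F, [p,q] <:+: l' → [p,q] <:+: l2) ∧ (∀ v ∈ F, v ∈ l2 → v ∈ l') := by
      intro a c x y hac hx' hy' hxy ha hc hxF hyF h1 h2 h3
      obtain ⟨A, E, hAE⟩ := hac
      rw [List.append_assoc] at hAE
      subst hAE
      have hnd := hl'.2.1
      have hac' : a ≠ c := by
        intro h; subst h; simp [List.nodup_append] at hnd
      refine ⟨A ++ ([a,x,y,c] ++ E), ?_, by simp; omega, ?_, ?_⟩
      · refine hl'.replace (by simp) (by simp) (by simp) (by simp [h1,h2,h3]) ?_ ?_ ?_ (by simp; omega)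
        · simp at hx' hy'
          simp [hac', hxy]; grind
        · simp [List.nodup_append] at hnd hx' hy' ⊢; grind
        · simp [List.nodup_append] at hnd hx' hy' ⊢; grind
      · exact fun p hp q hq hpq => pair_insert ha hc hp hq hpq
      · intro v hv
        simp; grind
    rcases hp a (by simp) c (by simp) hac with hac | hac
    · exact main a c x y hac hx' hy' hxy ha hc hxF hyF h1 h2 h3
    · exact main c a y x hac hy' hx' hxy.symm hc ha hyF hxF h3.symm h2.symm h1.symm
  obtain ⟨l2, hl2, hlen, q1, q2⟩ := key
  obtain ⟨l3, hl3, hlen3⟩ := h.2 l2 hl2 (fun p hpF q hqF hpq => by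
    rcases hp1 p hpF q hqF hpq with h | h
    · exact Or.inl (q1 p hpF q hqF h)
    · exact Or.inr (q1 q hqF p hpF h)) (fun v hv hv2 => hm1 v hv (q2 v hv hv2)) f le_rfl
  exact ⟨l3, hl3, by omega⟩

/-- off-cycle step -/
lemma Flex.offStep [DecidableEq V] {F : Finset V} {f : ℕ} {A I I' E : List V} {a x b w w' : V}
    (h : Flex R F f (A ++ a :: (I ++ x :: (I' ++ b :: E))))
    (hZ : ∀ v ∈ a :: (I ++ x :: (I' ++ [b])), v ∉ F)
    (hw : w ∉ (A ++ a :: (I ++ x :: (I' ++ b :: E)))) (hw' : w' ∉ (A ++ a :: (I ++ x :: (I' ++ b :: E))))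
    (hwF : w ∉ F) (hwF' : w' ∉ F) (hww : w ≠ w')
    (h1 : R.Adj a w) (h2 : R.Adj w b) (h3 : R.Adj w x) (h4 : R.Adj x w') (h5 : R.Adj w' b) :
    ∃ F' l1, F'.card ≤ F.card + 4 ∧ Flex R F f l1 ∧ Flex R F' (f+1) l1 ∧
      l1.length + I.length + I'.length = (A ++ a :: (I ++ x :: (I' ++ b :: E))).length := by
  have e : A ++ a :: (I ++ x :: (I' ++ b :: E)) = A ++ ((a :: (I ++ x :: (I' ++ [b]))) ++ E) := by simp
  rw [e] at h hw hw' ⊢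
  have hnd := h.1.2.1
  simp [List.nodup_append] at hnd hw hw'
  simp at hZ
  have hcyc : Cyc R (A ++ ([a,w,b] ++ E)) := by
    refine h.1.replace (by simp) (by simp [List.getLast?_append, List.getLast?_cons]) (by simp) (by simp [h1,h2]) ?_ ?_ ?_ (by simp; omega)
    · simp; grind
    · simp; grind
    · simp; grind
  have hF1 : Flex R F f (A ++ ([a,w,b] ++ E)) := by
    refine h.mv hcyc ?_ ?_
    · intro p hp q hq hpq
      left
      rcases pair_preserve hp hq (by simpa using hZ) (by simp) hpq with h | h
      · exact h.trans (List.prefix_append _ _).isInfix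
      · exact h.trans ⟨A ++ [a,w,b], [], by simp⟩
    · intro v hv; simp; grind
  refine ⟨F ∪ {w,b,x,w'}, _, ?_, hF1, hF1.sw (a := w) (c := b) (x := x) (y := w') ?_ ?_ ?_ ?_ hwF ?_ ?_ hwF' h3 h4 h5, ?_⟩
  · exact (Finset.card_union_le _ _).trans (by gcongr; exact Finset.card_le_four)
  · exact ⟨A ++ [a], E, by simp⟩
  · simp; grind
  · simp; grind
  · grind
  · grind
  · grind
  · simp; omega

/-- on-cycle step; `x ∈ I`, `y ∈ J` -/
lemma Flex.onStep [DecidableEq V] {F : Finset V} {f : ℕ} {A I M J E : List V} {a b c d a' c' x y : V}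
    (h : Flex R F f (A ++ a :: (I ++ b :: (M ++ c :: (J ++ d :: E)))))
    (hZ : ∀ v ∈ a :: (I ++ [b]), v ∉ F) (hZ' : ∀ v ∈ c :: (J ++ [d]), v ∉ F)
    (hx : x ∈ I ∨ x ∈ J) (hy : y ∈ I ∨ y ∈ J) (hxy : x ≠ y)
    (hac : R.Adj a c) (hbd : R.Adj b d) (hac' : (a' = a ∧ c' = c) ∨ (a' = c ∧ c' = a))
    (h1 : R.Adj a' x) (h2 : R.Adj x y) (h3 : R.Adj y c') :
    ∃ F' l1, F'.card ≤ F.card + 4 ∧ Flex R F f l1 ∧ Flex R F' (f+1) l1 ∧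
      l1.length + I.length + J.length = (A ++ a :: (I ++ b :: (M ++ c :: (J ++ d :: E)))).length := by
  wlog hw : a' = a ∧ c' = c generalizing a' c' x y
  · have hw' : a' = c ∧ c' = a := by tauto
    obtain ⟨rfl, rfl⟩ := hw'
    exact this hy hx hxy.symm (Or.inl ⟨rfl,rfl⟩) h3.symm h2.symm h1.symm ⟨rfl,rfl⟩
  obtain ⟨rfl, rfl⟩ := hw
  have e : A ++ a' :: (I ++ b :: (M ++ c' :: (J ++ d :: E))) =
      A ++ ((a' :: (I ++ b :: (M ++ c' :: (J ++ [d])))) ++ E) := by simp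
  rw [e] at h ⊢
  have hnd := h.1.2.1
  have hch : (b :: (M ++ [c'])).IsChain R.Adj := by
    have := h.1.2.2.left_of_append
    refine this.infix ⟨A ++ a' :: I, J ++ [d] ++ E, by simp⟩
  have hch' : (c' :: (M.reverse ++ [b])).IsChain R.Adj := by
    have := (List.isChain_reverse.2 (by simpa [flip, SimpleGraph.adj_comm] using hch) :
      (b :: (M ++ [c'])).reverse.IsChain R.Adj)
    simpa using this
  simp [List.nodup_append] at hnd
  simp at hZ hZ'
  have hcyc : Cyc R (A ++ ((a' :: c' :: (M.reverse ++ [b,d])) ++ E)) := by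
    refine h.1.replace (by simp) (by simp [List.getLast?_append, List.getLast?_cons]) (by simp) ?_ ?_ ?_ ?_ (by simp; omega)
    · have : (a' :: c' :: (M.reverse ++ [b,d])) = [a'] ++ ((c' :: (M.reverse ++ [b])) ++ [d]) := by simp
      rw [this, List.isChain_append, List.isChain_append]
      refine ⟨by simp, ⟨hch', by simp, ?_⟩, by simp [hac]⟩
      simp [List.getLast?_append, List.getLast?_cons, hbd]
    · simp [List.nodup_append]; grind
    · simp; grind
    · simp; grind
  have hF1 : Flex R F f (A ++ ((a' :: c' :: (M.reverse ++ [b,d])) ++ E)) := by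
    refine h.mv hcyc ?_ ?_
    · intro p hp q hq hpq
      have e2 : A ++ ((a' :: (I ++ b :: (M ++ c' :: (J ++ [d])))) ++ E) = 
        A ++ ((a' :: (I ++ [b])) ++ (M ++ ((c' :: (J ++ [d])) ++ E))) := by simp
      rw [e2] at hpq
      rcases pair_preserve hp hq (by simpa using hZ) (by simp) hpq with h | h
      · left; exact h.trans (List.prefix_append _ _).isInfix
      rcases pair_preserve hp hq (by simpa using hZ') (by simp) h with h | h
      · right
        have h' : [q,p] <:+: M.reverse := by simpa using List.reverse_infix.2 h
        exact h'.trans ⟨A ++ [a',c'], [b,d] ++ E, by simp⟩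
      · left; exact h.trans ⟨A ++ (a' :: c' :: (M.reverse ++ [b,d])), [], by simp⟩
    · intro v hv; simp; grind
  refine ⟨F ∪ {a',c',x,y}, _, ?_, hF1, hF1.sw (a := a') (c := c') (x := x) (y := y) ?_ ?_ ?_ hxy ?_ ?_ ?_ ?_ h1 h2 h3, ?_⟩
  · exact (Finset.card_union_le _ _).trans (by gcongr; exact Finset.card_le_four)
  · exact ⟨A, M.reverse ++ [b,d] ++ E, by simp⟩
  · simp; grind
  · simp; grind
  · grind
  · grind
  · grind
  · grind
  · simp; omega
end Part2


section Part3

lemma matrix_lemma (M B : ℕ) (E : Finset (ℕ × ℕ)) (hE : ∀ e ∈ E, e.1 < M ∧ e.2 < B)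
    (h : M + 2 * B + M * M < E.card) :
    ∃ a i b c l d, a < i ∧ i < b ∧ c < l ∧ l < d ∧ (a,c) ∈ E ∧ (a,l) ∈ E ∧ (i,c) ∈ E ∧
      (i,l) ∈ E ∧ (b,d) ∈ E := by
  classical
  let good : ℕ × ℕ → Prop := fun e => ∃ g ∈ E, e.1 < g.1 ∧ e.2 < g.2
  have h1 : (E.filter (fun e => ¬ good e)).card ≤ M + B := by
    rw [← Finset.card_range (M + B)]
    refine Finset.card_le_card_of_injOn (fun e => e.1 + B - e.2) ?_ ?_
    · intro e he
      simp at he ⊢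
      have := hE _ he.1; omega
    · intro e he e' he' hee
      simp at he he' hee
      have b1 := hE _ he.1
      have b2 := hE _ he'.1
      by_contra hne
      rcases Nat.lt_trichotomy e.1 e'.1 with h | h | h
      · exact he.2 ⟨e', he'.1, h, by omega⟩
      · exact hne (Prod.ext h (by omega))
      · exact he'.2 ⟨e, he.1, h, by omega⟩
  set G := E.filter good with hG
  have h2 : M * M + B < G.card := by
    have : G.card + (E.filter (fun e => ¬ good e)).card = E.card := by
      rw [hG]; convert Finset.card_filter_add_card_filter_not (s := E) (p := good)
    omega
  have h3 : (G.filter (fun e => ∀ e' ∈ G, e'.2 = e.2 → e.1 ≤ e'.1)).card ≤ B := by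
    rw [← Finset.card_range B]
    refine Finset.card_le_card_of_injOn (fun e => e.2) ?_ ?_
    · intro e he
      simp [hG] at he ⊢
      exact (hE _ he.1.1).2
    · intro e he e' he' hee
      rw [Finset.mem_coe, Finset.mem_filter] at he he'
      have a1 := he.2 _ he'.1 hee.symm
      have a2 := he'.2 _ he.1 hee
      exact Prod.ext (by omega) hee
  set H := G.filter (fun e => ¬ ∀ e' ∈ G, e'.2 = e.2 → e.1 ≤ e'.1) with hH
  have h4 : M * M < H.card := by
    have : (G.filter (fun e => ∀ e' ∈ G, e'.2 = e.2 → e.1 ≤ e'.1)).card + H.card = G.card := by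
      rw [hH]; convert Finset.card_filter_add_card_filter_not (s := G) (p := (fun e => ∀ e' ∈ G, e'.2 = e.2 → e.1 ≤ e'.1))
    omega
  have h5 : ∀ e, ∃ a, e ∈ H → (a < e.1 ∧ (a, e.2) ∈ E) := by
    intro e
    by_cases he : e ∈ H
    · rw [hH, Finset.mem_filter] at he
      have := he.2
      push Not at this
      obtain ⟨e', he', h1, h2⟩ := this
      refine ⟨e'.1, fun _ => ⟨h2, ?_⟩⟩
      rw [← h1]; exact (Finset.mem_filter.1 he').1
    · exact ⟨0, fun h => absurd h he⟩
  choose a ha using h5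
  have hHE : ∀ e ∈ H, e ∈ E ∧ good e := fun e he =>
    Finset.mem_filter.1 (Finset.mem_filter.1 he).1
  obtain ⟨e, he, e', he', hne, heq⟩ := Finset.exists_ne_map_eq_of_card_lt_of_maps_to
    (s := H) (t := Finset.range M ×ˢ Finset.range M) (f := fun e => (a e, e.1))
    (by simpa using h4) (by
      intro e he
      have := ha e he
      have := (hE e (hHE e he).1).1
      simp; omega)
  simp at heq
  obtain ⟨q1, q2⟩ := heq
  have main : ∀ e ∈ H, ∀ e' ∈ H, e.2 < e'.2 → a e = a e' → e.1 = e'.1 → 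
    ∃ a i b c l d, a < i ∧ i < b ∧ c < l ∧ l < d ∧ (a,c) ∈ E ∧ (a,l) ∈ E ∧ (i,c) ∈ E ∧
      (i,l) ∈ E ∧ (b,d) ∈ E := by
    intro e he e' he' hlt q1 q2
    obtain ⟨g, hg, g1, g2⟩ := (hHE e' he').2
    refine ⟨a e, e.1, g.1, e.2, e'.2, g.2, (ha e he).1, by omega, hlt, g2, (ha e he).2, ?_, (hHE e he).1, ?_, hg⟩
    · rw [q1]; exact (ha e' he').2
    · rw [q2]; exact (hHE e' he').1
  rcases Nat.lt_trichotomy e.2 e'.2 with h | h | h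
  · exact main e he e' he' h q1 q2
  · exact absurd (Prod.ext q2 h) hne
  · exact main e' he' e he h q1.symm q2.symm

variable {V : Type*} {R : SimpleGraph V}

/-- `u` enumerates `l`. -/
def Enum (l : List V) (u : ℕ → V) : Prop := ∀ i < l.length, l[i]? = some (u i)

lemma exists_enum (l : List V) (h : l ≠ []) : ∃ u, Enum l u := by
  obtain ⟨x, l, rfl⟩ := List.exists_cons_of_ne_nil h
  refine ⟨fun i => (x :: l).getD i x, fun i hi => ?_⟩
  show _ = some ((x :: l).getD i x)
  rw [List.getD_eq_getElem?_getD, List.getElem?_eq_getElem hi]; simp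

lemma Enum.split {l : List V} {u : ℕ → V} (h : Enum l u) {i : ℕ} (hi : i < l.length) :
    ∃ A E, l = A ++ u i :: E ∧ A.length = i ∧ (∀ v ∈ A, ∃ k < i, u k = v) ∧
      (∀ k < i, u k ∈ A) ∧ Enum E (fun j => u (i + 1 + j)) := by
  refine ⟨l.take i, l.drop (i+1), ?_, by simp; omega, ?_, ?_, ?_⟩
  · have := h i hi
    rw [List.getElem?_eq_getElem hi] at this
    simp at this
    rw [← this]; simp
  · intro v hv
    obtain ⟨k, hk, rfl⟩ := List.mem_iff_getElem.1 hv
    simp at hk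
    refine ⟨k, by omega, ?_⟩
    have := h k (by omega)
    rw [List.getElem?_eq_getElem (by omega)] at this
    simp at this; simp [this]
  · intro k hk
    have := h k (by omega)
    have h2 : (l.take i)[k]? = some (u k) := by rw [List.getElem?_take_of_lt hk, this]
    exact List.mem_of_getElem? h2
  · intro j hj
    simp at hj
    rw [List.getElem?_drop]; exact h _ (by omega)

lemma Enum.split_mem {l : List V} {u : ℕ → V} (h : Enum l u) {v : V} : v ∈ l ↔ ∃ i < l.length, u i = v := by
  constructor
  · intro hv
    obtain ⟨k, hk, rfl⟩ := List.mem_iff_getElem.1 hv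
    have := h k hk
    rw [List.getElem?_eq_getElem hk] at this
    simp at this
    exact ⟨k, hk, this.symm⟩
  · rintro ⟨i, hi, rfl⟩
    exact List.mem_of_getElem? (h i hi)

lemma Enum.inj {l : List V} {u : ℕ → V} (h : Enum l u) (hnd : l.Nodup) {i j : ℕ}
    (hi : i < l.length) (hj : j < l.length) (hij : u i = u j) : i = j := by
  have h1 := h i hi
  have h2 := h j hj
  rw [← hij, ← h1] at h2
  exact (List.getElem?_inj hi hnd).1 h2.symm

variable [DecidableEq V]

/-- off-cycle step with positions -/
lemma Flex.offStepPos {F : Finset V} {f : ℕ} {l : List V} {u : ℕ → V} (h : Flex R F f l)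
    (hu : Enum l u) {i j k : ℕ} (hij : i < j) (hjk : j < k) (hk : k < l.length)
    (hF : ∀ p, i ≤ p → p ≤ k → u p ∉ F) {w w' : V} (hw : w ∉ l) (hw' : w' ∉ l)
    (hwF : w ∉ F) (hwF' : w' ∉ F) (hww : w ≠ w')
    (h1 : R.Adj (u i) w) (h2 : R.Adj w (u k)) (h3 : R.Adj w (u j)) (h4 : R.Adj (u j) w')
    (h5 : R.Adj w' (u k)) :
    ∃ F' l1, F'.card ≤ F.card + 4 ∧ Flex R F f l1 ∧ Flex R F' (f+1) l1 ∧
      l1.length + (k - i - 2) = l.length := by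
  obtain ⟨A, E1, e1, hA, -, -, hE1⟩ := hu.split (i := i) (by omega)
  have l1 := congrArg List.length e1
  simp at l1
  obtain ⟨I, E2, e2, hI, hI', -, hE2⟩ := hE1.split (i := j - i - 1) (by omega)
  have l2 := congrArg List.length e2
  simp at l2
  obtain ⟨I', E3, e3, hIl', hI'', -, hE3⟩ := hE2.split (i := k - j - 1) (by omega)
  have a1 : i + 1 + (j - i - 1) = j := by omega
  have a2 : i + 1 + (j - i - 1 + 1 + (k - j - 1)) = k := by omega
  rw [a1] at e2
  rw [a2] at e3
  rw [e3] at e2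
  rw [e2] at e1
  subst e1
  obtain ⟨F', l1, q1, q2, q3, q4⟩ := h.offStep (by
    intro v hv
    simp at hv
    rcases hv with rfl | hv | rfl | hv | rfl
    · exact hF _ le_rfl (by omega)
    · obtain ⟨p, hp, rfl⟩ := hI' v hv
      exact hF _ (by omega) (by omega)
    · exact hF _ (by omega) (by omega)
    · obtain ⟨p, hp, rfl⟩ := hI'' v hv
      exact hF _ (by omega) (by omega)
    · exact hF _ (by omega) (by omega)) hw hw' hwF hwF' hww h1 h2 h3 h4 h5
  exact ⟨F', l1, q1, q2, q3, by omega⟩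

lemma Flex.onStepPos {F : Finset V} {f : ℕ} {l : List V} {u : ℕ → V} (h : Flex R F f l)
    (hu : Enum l u) {a x b c y d : ℕ} (hax : a < x) (hxb : x < b) (hbc : b < c) (hcy : c < y)
    (hyd : y < d) (hd : d < l.length)
    (hF : ∀ p, a ≤ p → p ≤ b → u p ∉ F) (hF' : ∀ p, c ≤ p → p ≤ d → u p ∉ F)
    (h1 : R.Adj (u a) (u c)) (h2 : R.Adj (u b) (u d)) (h3 : R.Adj (u a) (u y))
    (h4 : R.Adj (u x) (u y)) (h5 : R.Adj (u x) (u c)) :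
    ∃ F' l1, F'.card ≤ F.card + 4 ∧ Flex R F f l1 ∧ Flex R F' (f+1) l1 ∧
      l1.length + (b - a - 1) + (d - c - 1) = l.length := by
  obtain ⟨A, E1, e1, hA, -, -, hE1⟩ := hu.split (i := a) (by omega)
  have l1 := congrArg List.length e1
  simp at l1
  obtain ⟨I, E2, e2, hI, hI', hIm, hE2⟩ := hE1.split (i := b - a - 1) (by omega)
  have l2 := congrArg List.length e2
  simp at l2
  obtain ⟨M, E3, e3, hM, hM', -, hE3⟩ := hE2.split (i := c - b - 1) (by omega)
  have l3 := congrArg List.length e3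
  simp at l3
  obtain ⟨J, E4, e4, hJ, hJ', hJm, hE4⟩ := hE3.split (i := d - c - 1) (by omega)
  have a1 : a + 1 + (b - a - 1) = b := by omega
  have a2 : a + 1 + (b - a - 1 + 1 + (c - b - 1)) = c := by omega
  have a3 : a + 1 + (b - a - 1 + 1 + (c - b - 1 + 1 + (d - c - 1))) = d := by omega
  rw [a1] at e2
  rw [a2] at e3
  rw [a3] at e4
  rw [e4] at e3
  rw [e3] at e2
  rw [e2] at e1
  have hxy : u x ≠ u y := h4.ne
  subst e1
  obtain ⟨F', l1, q1, q2, q3, q4⟩ := h.onStep (x := u y) (y := u x) (a' := u a) (c' := u c) (by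
    intro v hv
    simp at hv
    rcases hv with rfl | hv | rfl
    · exact hF _ le_rfl (by omega)
    · obtain ⟨p, hp, rfl⟩ := hI' v hv
      exact hF _ (by omega) (by omega)
    · exact hF _ (by omega) (by omega)) (by
    intro v hv
    simp at hv
    rcases hv with rfl | hv | rfl
    · exact hF' _ le_rfl (by omega)
    · obtain ⟨p, hp, rfl⟩ := hJ' v hv
      exact hF' _ (by omega) (by omega)
    · exact hF' _ (by omega) (by omega)) (by
      right
      have := hJm (y - c - 1) (by omega)
      convert this using 2
      omega) (by
      left
      have := hIm (x - a - 1) (by omega)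
      convert this using 2
      omega) hxy.symm h1 h2 (Or.inl ⟨rfl, rfl⟩) h3 h4.symm h5
  exact ⟨F', l1, q1, q2, q3, by omega⟩

end Part3


section Part4
variable {V : Type*} {R : SimpleGraph V} [DecidableEq V] [DecidableRel R.Adj]

/-- The desired outcome of a step. -/
def Good (R : SimpleGraph V) (F : Finset V) (f : ℕ) (l : List V) (r : ℕ) : Prop :=
  ∃ (F' : Finset V) (l1 : List V) (e : ℕ), F'.card ≤ F.card + 4 ∧ Flex R F f l1 ∧ Flex R F' (f+1) l1 ∧
    1 ≤ e ∧ e ≤ r ∧ l1.length + 2 * e = l.length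

lemma class_step {F : Finset V} {f : ℕ} {l : List V} {u : ℕ → V} (h : Flex R F f l)
    (hu : Enum l u) {M B s0 q : ℕ} (hM : 1 ≤ M) (hB : B = 2 * M * M)
    (hs : s0 + 2 * M ≤ l.length) (hq : q + 2 * B ≤ l.length + 1)
    (hF : ∀ p, s0 ≤ p → p < s0 + 2 * M → u p ∉ F)
    (hF' : ∀ p, q ≤ p → p + 1 < q + 2 * B → u p ∉ F)
    (hsep : s0 + 2 * M ≤ q ∨ q + 2 * B ≤ s0 + 1)
    (hbig : 3 * B < ∑ j ∈ Finset.range B, ((Finset.range M).filter (fun i => R.Adj (u (s0 + 2 * i)) (u (q + 2 * j)))).card) :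
    Good R F f l (M + B) := by
  classical
  set E := (Finset.range M ×ˢ Finset.range B).filter (fun e => R.Adj (u (s0 + 2 * e.1)) (u (q + 2 * e.2))) with hE
  have hcard : E.card = ∑ j ∈ Finset.range B, ((Finset.range M).filter (fun i => R.Adj (u (s0 + 2 * i)) (u (q + 2 * j)))).card := by
    rw [hE, Finset.card_filter, Finset.sum_product_right]
    refine Finset.sum_congr rfl fun j _ => ?_
    rw [Finset.card_filter]
  have hmem : ∀ e, e ∈ E ↔ (e.1 < M ∧ e.2 < B) ∧ R.Adj (u (s0 + 2 * e.1)) (u (q + 2 * e.2)) := by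
    intro e; simp [hE]
  obtain ⟨a, i, b, c, y, d, hai, hib, hcy, hyd, q1, q2, q3, q4, q5⟩ := matrix_lemma M B E
    (fun e he => ((hmem e).1 he).1) (by nlinarith)
  simp only [hmem] at q1 q2 q3 q4 q5
  rcases hsep with hsep | hsep
  · obtain ⟨F', l1, r1, r2, r3, r4⟩ := h.onStepPos hu (a := s0 + 2 * a) (x := s0 + 2 * i) (b := s0 + 2 * b)
      (c := q + 2 * c) (y := q + 2 * y) (d := q + 2 * d) (by omega) (by omega) (by omega) (by omega)
      (by omega) (by omega) (fun p _ _ => hF p (by omega) (by omega))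
      (fun p _ _ => hF' p (by omega) (by omega)) q1.2 q5.2 q2.2 q4.2 q3.2
    exact ⟨F', l1, (b - a) + (d - c) - 1, r1, r2, r3, by omega, by omega, by omega⟩
  · obtain ⟨F', l1, r1, r2, r3, r4⟩ := h.onStepPos hu (a := q + 2 * c) (x := q + 2 * y) (b := q + 2 * d)
      (c := s0 + 2 * a) (y := s0 + 2 * i) (d := s0 + 2 * b) (by omega) (by omega) (by omega) (by omega)
      (by omega) (by omega) 
      (fun p _ _ => hF' p (by omega) (by omega)) (fun p _ _ => hF p (by omega) (by omega))
      q1.2.symm q5.2.symm q3.2.symm q4.2.symm q2.2.symm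
    exact ⟨F', l1, (b - a) + (d - c) - 1, r1, r2, r3, by omega, by omega, by omega⟩

lemma three_of_card {M : ℕ} {p : ℕ → Prop} [DecidablePred p] (h : 3 ≤ ((Finset.range M).filter p).card) :
    ∃ a b c, a < b ∧ b < c ∧ c < M ∧ p a ∧ p b ∧ p c := by
  obtain ⟨a, b, c, ha, hb, hc, hab, hac, hbc⟩ := Finset.two_lt_card_iff.1 h
  simp only [Finset.mem_filter, Finset.mem_range] at ha hb hc
  rcases Nat.lt_or_gt_of_ne hab with h1 | h1 <;> rcases Nat.lt_or_gt_of_ne hac with h2 | h2 <;>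
    rcases Nat.lt_or_gt_of_ne hbc with h3 | h3
  · exact ⟨a, b, c, h1, h3, hc.1, ha.2, hb.2, hc.2⟩
  · exact ⟨a, c, b, h2, h3, hb.1, ha.2, hc.2, hb.2⟩
  · omega
  · exact ⟨c, a, b, h2, h1, hb.1, hc.2, ha.2, hb.2⟩
  · exact ⟨b, a, c, h1, h2, hc.1, hb.2, ha.2, hc.2⟩
  · omega
  · exact ⟨b, c, a, h3, h2, ha.1, hb.2, hc.2, ha.2⟩
  · exact ⟨c, b, a, h3, h1, ha.1, hc.2, hb.2, ha.2⟩

lemma off_step {F : Finset V} {f : ℕ} {l : List V} {u : ℕ → V} (h : Flex R F f l)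
    (hu : Enum l u) {M s0 : ℕ}
    (hs : s0 + 2 * M ≤ l.length)
    (hF : ∀ p, s0 ≤ p → p < s0 + 2 * M → u p ∉ F)
    (H : Finset V) (hH : ∀ w ∈ H, w ∉ l ∧ w ∉ F ∧ 3 ≤ ((Finset.range M).filter (fun i => R.Adj (u (s0 + 2 * i)) w)).card)
    (hbig : M * (M * M) < H.card) :
    Good R F f l M := by
  classical
  have h1 : ∀ w, ∃ t : ℕ × ℕ × ℕ, w ∈ H → t.1 < t.2.1 ∧ t.2.1 < t.2.2 ∧ t.2.2 < M ∧ R.Adj (u (s0 + 2 * t.1)) w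
      ∧ R.Adj (u (s0 + 2 * t.2.1)) w ∧ R.Adj (u (s0 + 2 * t.2.2)) w := by
    intro w
    by_cases hw : w ∈ H
    · obtain ⟨a, b, c, h⟩ := three_of_card (hH w hw).2.2
      exact ⟨(a,b,c), fun _ => h⟩
    · exact ⟨(0,0,0), fun h => absurd h hw⟩
  choose t ht using h1
  obtain ⟨w, hw, w', hw', hne, heq⟩ := Finset.exists_ne_map_eq_of_card_lt_of_maps_to
    (s := H) (t := Finset.range M ×ˢ Finset.range M ×ˢ Finset.range M) (f := t)
    (by simpa using hbig) (by
      intro w hw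
      have := ht w hw
      simp; omega)
  have t1 := ht w hw
  have t2 := ht w' hw'
  rw [← heq] at t2
  obtain ⟨F', l1, r1, r2, r3, r4⟩ := h.offStepPos hu (i := s0 + 2 * (t w).1) (j := s0 + 2 * (t w).2.1)
    (k := s0 + 2 * (t w).2.2) (by omega) (by omega) (by omega) (fun p _ _ => hF p (by omega) (by omega))
    (hH w hw).1 (hH w' hw').1 (hH w hw).2.1 (hH w' hw').2.1 hne t1.2.2.2.1 t1.2.2.2.2.2.symm
    t1.2.2.2.2.1.symm t2.2.2.2.2.1 t2.2.2.2.2.2.symm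
  exact ⟨F', l1, (t w).2.2 - (t w).1 - 1, r1, r2, r3, by omega, by omega, by omega⟩

lemma sum_blocks (T K : ℕ) (g : ℕ → ℕ) :
    ∑ p ∈ Finset.range (T * K), g p = ∑ k ∈ Finset.range K, ∑ r ∈ Finset.range T, g (T * k + r) := by
  induction K with
  | zero => simp
  | succ K ih => rw [Nat.mul_succ, Finset.sum_range_add, ih, Finset.sum_range_succ]

lemma sum_parity (B : ℕ) (g : ℕ → ℕ) :
    ∑ p ∈ Finset.range (2 * B), g p = ∑ k ∈ Finset.range B, g (2 * k) + ∑ k ∈ Finset.range B, g (2 * k + 1) := by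
  induction B with
  | zero => simp
  | succ B ih => 
    rw [Nat.mul_succ, Finset.sum_range_succ, Finset.sum_range_succ, ih, Finset.sum_range_succ, Finset.sum_range_succ]
    ring

lemma flex_step [Fintype V] {N m : ℕ} (hN : 1 ≤ N) (hdeg : ∀ v, m ≤ 2 * R.degree v)
    (hn : Fintype.card V ≤ N * m) (hm : 17280000000 * N ^ 9 ≤ m)
    {F : Finset V} {f : ℕ} {l : List V} (h : Flex R F f l) (hl : m ≤ l.length)
    (hFc : F.card ≤ 840 * N ^ 2) : Good R F f l (210 * N ^ 2) := by
  classical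
  have hle : ∀ r, r ≤ 210 * N ^ 2 → Good R F f l r → Good R F f l (210 * N ^ 2) := by
    rintro r hr ⟨F', l1, e, h1, h2, h3, h4, h5, h6⟩
    exact ⟨F', l1, e, h1, h2, h3, h4, h5.trans hr, h6⟩
  by_contra hcon
  have hnd := h.1.2.1
  obtain ⟨u, hu⟩ := exists_enum l (by rintro rfl; have := h.1.1; simp at this)
  obtain ⟨M, hM⟩ : ∃ M, M = 10 * N := ⟨_, rfl⟩
  obtain ⟨B, hB⟩ : ∃ B, B = 2 * M * M := ⟨_, rfl⟩
  have hMB : M + B ≤ 210 * N ^ 2 := by rw [hB, hM]; nlinarith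
  obtain ⟨T, hT⟩ : ∃ T, T = 2 * B := ⟨_, rfl⟩
  have hTpos : 0 < T := by rw [hT, hB, hM]; positivity
  have hMT : 2 * M ≤ T := by rw [hT, hB]; nlinarith
  have hn1 : l.length ≤ Fintype.card V := by
    rw [← List.toFinset_card_of_nodup hnd]; exact Finset.card_le_univ _
  obtain ⟨L, hL⟩ : ∃ L, L = l.length := ⟨_, rfl⟩
  set K := L / T with hK
  have hTK : T * K ≤ L := Nat.mul_div_le L T
  have hTK' : L < T * K + T := by
    have := Nat.lt_mul_div_succ L hTpos
    rw [Nat.mul_succ] at this; exact this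
  -- numeric
  have hnum : M * (M * (M * M)) + M * F.card + M * T * (F.card + 2) < 2 * m := by
    have e1 : M * (M * (M * M)) = 10000 * N ^ 4 := by rw [hM]; ring
    have e2 : M * F.card ≤ 8400 * N ^ 3 := by rw [hM]; nlinarith [mul_le_mul_right hFc N]
    have e3 : M * T * (F.card + 2) ≤ 4000 * N ^ 3 * (842 * N ^ 2) := by
      have : M * T = 4000 * N ^ 3 := by rw [hT, hB, hM]; ring
      rw [this]; gcongr; nlinarith
    have f1 : N ^ 4 ≤ N ^ 9 := Nat.pow_le_pow_right hN (by norm_num)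
    have f2 : N ^ 3 ≤ N ^ 9 := Nat.pow_le_pow_right hN (by norm_num)
    have f3 : N ^ 5 ≤ N ^ 9 := Nat.pow_le_pow_right hN (by norm_num)
    have f4 : 1 ≤ N ^ 9 := Nat.one_le_pow _ _ hN
    have e4 : 4000 * N ^ 3 * (842 * N ^ 2) = 3368000 * N ^ 5 := by ring
    omega
  have hKF : F.card < K := by
    rw [hK, Nat.lt_iff_add_one_le, Nat.le_div_iff_mul_le hTpos]
    have : (F.card + 1) * T ≤ M * T * (F.card + 2) := by
      have : 1 ≤ M := by omega
      calc (F.card + 1) * T ≤ (F.card + 2) * (M * T) := by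
            gcongr; omega; nlinarith
        _ = _ := by ring
    have h2 : (F.card + 1) * T * 2 ≤ M * T * (F.card + 2) := by
      have : 2 ≤ M := by omega
      calc (F.card + 1) * T * 2 ≤ (F.card + 2) * (2 * T) := by nlinarith
        _ ≤ (F.card + 2) * (M * T) := by gcongr
        _ = _ := by ring
    omega
  set bad := (Finset.range K).filter (fun k => ∃ r < T, u (T * k + r) ∈ F) with hbad
  have hblk : ∀ k < K, ∀ r < T, T * k + r < L := by
    intro k hk r hr
    have : T * (k + 1) ≤ T * K := Nat.mul_le_mul_left _ hk
    rw [Nat.mul_succ] at this; omega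
  have hbadc : bad.card ≤ F.card := by
    have h1 : ∀ k, ∃ r, k ∈ bad → r < T ∧ u (T * k + r) ∈ F := by
      intro k
      by_cases hk : k ∈ bad
      · obtain ⟨r, hr⟩ := (Finset.mem_filter.1 hk).2
        exact ⟨r, fun _ => hr⟩
      · exact ⟨0, fun h => absurd h hk⟩
    choose r hr using h1
    refine Finset.card_le_card_of_injOn (fun k => u (T * k + r k)) (fun k hk => (hr k hk).2) ?_
    intro k hk k' hk' hkk
    have b1 := Finset.mem_range.1 (Finset.mem_filter.1 hk).1
    have b2 := Finset.mem_range.1 (Finset.mem_filter.1 hk').1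
    have := hu.inj hnd (hL ▸ hblk k b1 _ (hr k hk).1) (hL ▸ hblk k' b2 _ (hr k' hk').1) hkk
    have c1 : (T * k + r k) / T = k := by
      rw [Nat.mul_add_div hTpos, Nat.div_eq_of_lt (hr k hk).1]; omega
    have c2 : (T * k' + r k') / T = k' := by
      rw [Nat.mul_add_div hTpos, Nat.div_eq_of_lt (hr k' hk').1]; omega
    rw [← c1, this, c2]
  obtain ⟨k0, hk0, hk0'⟩ : ∃ k0 < K, k0 ∉ bad := by
    by_contra hno
    push Not at hno
    have : Finset.range K ⊆ bad := fun k hk => hno k (Finset.mem_range.1 hk)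
    have := Finset.card_le_card this
    simp at this; omega
  have hgoodF : ∀ k < K, k ∉ bad → ∀ p, T * k ≤ p → p < T * k + T → u p ∉ F := by
    intro k hk hkb p hp hp' hpF
    exact hkb (Finset.mem_filter.2 ⟨Finset.mem_range.2 hk, p - T * k, by omega, by
      rwa [Nat.add_sub_cancel' hp]⟩)
  set s0 := T * k0 with hs0
  have hs0L : s0 + T ≤ L := by have := hblk k0 hk0 (T-1) (by omega); omega
  let g : V → ℕ := fun w => ((Finset.range M).filter (fun i => R.Adj (u (s0 + 2 * i)) w)).card
  have hgM : ∀ w, g w ≤ M := fun w => (Finset.card_filter_le _ _).trans (by simp)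
  have hlow : 5 * Fintype.card V ≤ ∑ w, g w := by
    have e1 : ∑ w, g w = ∑ i ∈ Finset.range M, R.degree (u (s0 + 2 * i)) := by
      simp only [g, Finset.card_filter]
      rw [Finset.sum_comm]
      refine Finset.sum_congr rfl fun i _ => ?_
      rw [← SimpleGraph.card_neighborFinset_eq_degree, SimpleGraph.neighborFinset_eq_filter, Finset.card_filter]
    have e2 : M * m ≤ 2 * ∑ i ∈ Finset.range M, R.degree (u (s0 + 2 * i)) := by
      rw [Finset.mul_sum]
      calc M * m = ∑ i ∈ Finset.range M, m := by simp
        _ ≤ _ := Finset.sum_le_sum fun i _ => hdeg _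
    rw [e1]
    have e3 : M * m = 10 * (N * m) := by rw [hM]; ring
    omega
  -- off-cycle bound
  set H := (Finset.univ : Finset V).filter (fun w => w ∉ l ∧ w ∉ F ∧ 3 ≤ g w) with hH
  have hHc : H.card ≤ M * (M * M) := by
    by_contra hc
    push Not at hc
    exact hcon (hle M (by omega) (off_step h hu (by omega) (fun p h1 h2 => hgoodF k0 hk0 hk0' p (by omega) (by omega)) H
      (fun w hw => (Finset.mem_filter.1 hw).2) hc))
  have hoff : ∑ w ∈ (Finset.univ \ l.toFinset), g w ≤ 2 * (Fintype.card V - L) + M * F.card + M * (M * (M * M)) := by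
    have e1 : ∀ w ∈ (Finset.univ \ l.toFinset), g w ≤ 2 + (if w ∈ F then M else 0) + (if w ∈ H then M else 0) := by
      intro w hw
      simp at hw
      by_cases hwF : w ∈ F
      · have := hgM w
        simp [hwF]; omega
      · by_cases h3 : 3 ≤ g w
        · have : w ∈ H := by simp [hH, hw, hwF, h3]
          have := hgM w
          simp [*]; omega
        · omega
    refine (Finset.sum_le_sum e1).trans ?_
    rw [Finset.sum_add_distrib, Finset.sum_add_distrib]
    have c1 : ∑ w ∈ (Finset.univ \ l.toFinset), 2 = 2 * (Fintype.card V - L) := by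
      rw [Finset.sum_const, Finset.card_sdiff, Finset.inter_univ, List.toFinset_card_of_nodup hnd, ← hL, Finset.card_univ, smul_eq_mul, mul_comm]
    have c2 : ∀ S : Finset V, ∑ w ∈ (Finset.univ \ l.toFinset), (if w ∈ S then M else 0) ≤ M * S.card := by
      intro S
      rw [← Finset.sum_filter, Finset.sum_const, smul_eq_mul, mul_comm]
      gcongr
      intro w hw
      exact (Finset.mem_filter.1 hw).2
    have := c2 F
    have := (c2 H).trans (Nat.mul_le_mul_left M hHc)
    omega
  -- on-cycle bound
  have hon : ∑ w ∈ l.toFinset, g w = ∑ p ∈ Finset.range L, g (u p) := by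
    have : l.toFinset = (Finset.range L).image u := by
      ext v; rw [List.mem_toFinset, hu.split_mem]; simp [hL]
    rw [this, Finset.sum_image]
    intro i hi j hj hij
    simp [hL] at hi hj
    exact hu.inj hnd hi hj hij
  have hblock : ∀ k < K, ∑ r ∈ Finset.range T, g (u (T * k + r)) ≤ 3 * T + (if k ∈ bad ∪ {k0} then M * T else 0) := by
    intro k hk
    split_ifs with hkb
    · have : ∑ r ∈ Finset.range T, g (u (T * k + r)) ≤ ∑ r ∈ Finset.range T, M := Finset.sum_le_sum fun _ _ => hgM _
      rw [Finset.sum_const, Finset.card_range, smul_eq_mul, mul_comm T M] at this; omega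
    · simp at hkb
      obtain ⟨hkb, hkk⟩ := hkb
      have hcl : ∀ q, (q = T * k ∨ q = T * k + 1) → ∑ j ∈ Finset.range B, g (u (q + 2 * j)) ≤ 3 * B := by
        intro q hq
        by_contra hc
        push Not at hc
        have hTk : T * k + T ≤ L := by have := hblk k hk (T-1) (by omega); omega
        refine hcon (hle (M + B) hMB (class_step h hu (q := q) (by omega) hB (by omega) (by omega)
          (fun p h1 h2 => hgoodF k0 hk0 hk0' p (by omega) (by omega))
          (fun p h1 h2 => hgoodF k hk hkk p (by omega) (by omega)) ?_ hc))
        rcases Nat.lt_or_gt_of_ne hkb with hlt | hlt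
        · right
          have : T * (k + 1) ≤ T * k0 := Nat.mul_le_mul_left _ hlt
          rw [Nat.mul_succ] at this; omega
        · left
          have : T * (k0 + 1) ≤ T * k := Nat.mul_le_mul_left _ hlt
          rw [Nat.mul_succ] at this; omega
      have := sum_parity B (fun r => g (u (T * k + r)))
      rw [hT] at this ⊢
      rw [this]
      have c1 := hcl (T * k) (Or.inl rfl)
      have c2 := hcl (T * k + 1) (Or.inr rfl)
      have c3 : ∀ j, T * k + 1 + 2 * j = 2 * B * k + (2 * j + 1) := by intro j; rw [hT]; ring
      simp only [c3] at c2
      rw [hT] at c1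
      omega
  have hon2 : ∑ p ∈ Finset.range L, g (u p) ≤ 3 * L + M * T * (F.card + 2) := by
    have e1 : L = T * K + (L - T * K) := by omega
    have e2 : ∑ p ∈ Finset.range L, g (u p) = ∑ p ∈ Finset.range (T * K), g (u p) +
        ∑ p ∈ Finset.range (L - T * K), g (u (T * K + p)) := by
      conv_lhs => rw [e1]
      exact Finset.sum_range_add _ _ _
    have e3 : ∑ p ∈ Finset.range (L - T * K), g (u (T * K + p)) ≤ M * T := by
      calc _ ≤ ∑ p ∈ Finset.range (L - T * K), M := Finset.sum_le_sum fun _ _ => hgM _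
        _ = M * (L - T * K) := by simp [mul_comm]
        _ ≤ M * T := by gcongr; omega
    have e4 : ∑ p ∈ Finset.range (T * K), g (u p) ≤ 3 * (T * K) + M * T * (F.card + 1) := by
      rw [sum_blocks T K (fun p => g (u p))]
      refine (Finset.sum_le_sum fun k hk => hblock k (Finset.mem_range.1 hk)).trans ?_
      rw [Finset.sum_add_distrib, Finset.sum_const, Finset.card_range, smul_eq_mul, ← Finset.sum_filter,
        Finset.sum_const, smul_eq_mul]
      have : ((Finset.range K).filter (fun k => k ∈ bad ∪ {k0})).card ≤ F.card + 1 := by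
        calc _ ≤ (bad ∪ {k0}).card := Finset.card_le_card fun w hw => (Finset.mem_filter.1 hw).2
          _ ≤ bad.card + 1 := (Finset.card_union_le _ _).trans (by simp)
          _ ≤ _ := by omega
      calc _ ≤ K * (3 * T) + (F.card + 1) * (M * T) := by gcongr
        _ = _ := by ring
    have : M * T * (F.card + 2) = M * T * (F.card + 1) + M * T := by ring
    omega
  have htot : ∑ w, g w = ∑ w ∈ (Finset.univ \ l.toFinset), g w + ∑ w ∈ l.toFinset, g w :=
    (Finset.sum_sdiff (Finset.subset_univ _)).symm
  omega

lemma partA [Fintype V] {N m : ℕ} (hN : 1 ≤ N) (hdeg : ∀ v, m ≤ 2 * R.degree v)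
    (hn : Fintype.card V ≤ N * m) (hm : 17280000000 * N ^ 9 ≤ m) (hme : Even m)
    {l : List V} (h : Cyc R l) (hl : m + 420 * N ^ 2 * (210 * N ^ 2) ≤ l.length) (hle : Even l.length) :
    HasCycleLen R m := by
  obtain ⟨F0, hF0⟩ : ∃ F0, F0 = 210 * N ^ 2 := ⟨_, rfl⟩
  have main : ∀ n : ℕ, ∀ (l : List V) (F : Finset V) (f : ℕ), l.length = n → Flex R F f l → f ≤ F0 →
      F.card ≤ 4 * f → Even l.length → m + 2 * F0 * (F0 - f) ≤ l.length → HasCycleLen R m := by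
    intro n
    induction n using Nat.strong_induction_on with
    | _ n ih =>
      intro l F f hln hfl hf hFc hev hlong
      by_cases hlm : l.length = m
      · rw [← hlm]; exact hfl.1.hasCycleLen
      obtain ⟨F', l1, e, a1, a2, a3, a4, a5, a6⟩ := flex_step hN hdeg hn hm hfl (by omega) (by omega)
      rw [← hF0] at a5
      have hev1 : Even l1.length := by
        rw [← a6] at hev
        rw [Nat.even_add] at hev
        exact hev.2 (even_two_mul e)
      rcases Nat.lt_or_ge f F0 with hlt | hge
      · refine ih l1.length (by omega) l1 F' (f+1) rfl a3 hlt (by omega) hev1 ?_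
        have : F0 - f = (F0 - (f+1)) + 1 := by omega
        rw [this, Nat.mul_succ] at hlong
        omega
      · have hfe : f = F0 := by omega
        subst hfe
        rcases Nat.lt_or_ge l1.length m with hlt | hge
        · obtain ⟨j, hj⟩ : ∃ j, m = l1.length + 2 * j := by
            obtain ⟨x, hx⟩ := hme
            obtain ⟨y, hy⟩ := hev1
            exact ⟨x - y, by omega⟩
          obtain ⟨l2, h2, h2l⟩ := a2.self (j := j) (by
            simp at hlong; omega)
          rw [hj, ← h2l]; exact h2.hasCycleLen
        · exact ih l1.length (by omega) l1 F f rfl a2 hf hFc hev1 (by simpa using hge)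
  refine main _ l ∅ 0 rfl (Flex.base h) (by omega) (by simp) hle ?_
  rw [hF0, Nat.sub_zero]
  convert hl using 2
  ring

end Part4


section Part5
variable {V : Type*} {R : SimpleGraph V} 

/-- walk in `X` from `x` to `y` as a list -/
def Wk (R : SimpleGraph V) (X : Finset V) (x y : V) (l : List V) : Prop :=
  l.IsChain R.Adj ∧ l.head? = some x ∧ l.getLast? = some y ∧ ∀ v ∈ l, v ∈ X

/-- path in `X` from `x` to `y` as a list -/
def Pth (R : SimpleGraph V) (X : Finset V) (x y : V) (l : List V) : Prop :=
  l.Nodup ∧ Wk R X x y l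

lemma isChain_rev {l : List V} (h : l.IsChain R.Adj) : l.reverse.IsChain R.Adj :=
  List.isChain_reverse.2 (by simpa [flip, SimpleGraph.adj_comm] using h)

lemma Wk.rev {X : Finset V} {x y : V} {l : List V} (h : Wk R X x y l) : Wk R X y x l.reverse :=
  ⟨isChain_rev h.1, by simpa using h.2.2.1, by simpa using h.2.1, by simpa using h.2.2.2⟩

lemma Pth.rev {X : Finset V} {x y : V} {l : List V} (h : Pth R X x y l) : Pth R X y x l.reverse :=
  ⟨by simpa using h.1, h.2.rev⟩

lemma Wk.mono {X Y : Finset V} (hXY : X ⊆ Y) {x y : V} {l : List V} (h : Wk R X x y l) : Wk R Y x y l :=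
  ⟨h.1, h.2.1, h.2.2.1, fun v hv => hXY (h.2.2.2 v hv)⟩

lemma Pth.mono {X Y : Finset V} (hXY : X ⊆ Y) {x y : V} {l : List V} (h : Pth R X x y l) : Pth R Y x y l :=
  ⟨h.1, h.2.mono hXY⟩

lemma Wk.left_mem {X : Finset V} {x y : V} {l : List V} (h : Wk R X x y l) : x ∈ l :=
  List.mem_of_mem_head? h.2.1

lemma Wk.right_mem {X : Finset V} {x y : V} {l : List V} (h : Wk R X x y l) : y ∈ l :=
  List.mem_of_mem_getLast? h.2.2.1

lemma Wk.ne_nil {X : Finset V} {x y : V} {l : List V} (h : Wk R X x y l) : l ≠ [] :=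
  List.ne_nil_of_mem h.left_mem

lemma Wk.single {X : Finset V} {x : V} (hx : x ∈ X) : Wk R X x x [x] := by
  simp [Wk, hx]

lemma Pth.single {X : Finset V} {x : V} (hx : x ∈ X) : Pth R X x x [x] :=
  ⟨by simp, Wk.single hx⟩

/-- join two walks by an edge -/
lemma Wk.join {X : Finset V} {x y z w : V} {l l' : List V} (h : Wk R X x y l) (h' : Wk R X z w l')
    (hyz : R.Adj y z) : Wk R X x w (l ++ l') := by
  refine ⟨?_, ?_, ?_, ?_⟩
  · rw [List.isChain_append]
    refine ⟨h.1, h'.1, fun a ha b hb => ?_⟩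
    rw [h.2.2.1] at ha; rw [h'.2.1] at hb
    simp at ha hb; subst ha; subst hb; exact hyz
  · rw [List.head?_append, h.2.1]; rfl
  · rw [List.getLast?_append, h'.2.2.1]; rfl
  · intro v hv
    rcases List.mem_append.1 hv with hv | hv
    · exact h.2.2.2 v hv
    · exact h'.2.2.2 v hv

lemma Pth.join {X : Finset V} {x y z w : V} {l l' : List V} (h : Pth R X x y l) (h' : Pth R X z w l')
    (hyz : R.Adj y z) (hd : ∀ v ∈ l, v ∉ l') : Pth R X x w (l ++ l') :=
  ⟨List.nodup_append.2 ⟨h.1, h'.1, by rintro a ha b hb rfl; exact hd a ha hb⟩, h.2.join h'.2 hyz⟩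

/-- prefix of a walk up to an occurrence. -/
lemma Wk.pre {X : Finset V} {x y v : V} {A E : List V} (h : Wk R X x y (A ++ v :: E)) :
    Wk R X x v (A ++ [v]) := by
  refine ⟨h.1.infix ⟨[], E, by simp⟩, ?_, by simp, ?_⟩
  · have := h.2.1
    cases A <;> simpa using this
  · intro w hw; exact h.2.2.2 w (by simp at hw ⊢; tauto)

lemma Wk.suf {X : Finset V} {x y v : V} {A E : List V} (h : Wk R X x y (A ++ v :: E)) :
    Wk R X v y (v :: E) := by
  refine ⟨h.1.infix ⟨A, [], by simp⟩, by simp, ?_, ?_⟩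
  · have := h.2.2.1
    simpa [List.getLast?_append, List.getLast?_cons] using this
  · intro w hw; exact h.2.2.2 w (by simp at hw ⊢; tauto)

lemma Pth.pre {X : Finset V} {x y v : V} {A E : List V} (h : Pth R X x y (A ++ v :: E)) :
    Pth R X x v (A ++ [v]) :=
  ⟨h.1.sublist (by simp), h.2.pre⟩

lemma Pth.suf {X : Finset V} {x y v : V} {A E : List V} (h : Pth R X x y (A ++ v :: E)) :
    Pth R X v y (v :: E) := ⟨h.1.sublist (by simp), h.2.suf⟩

/-- a minimal walk -/
lemma Wk.min {X : Finset V} {x y : V} {l : List V} (h : Wk R X x y l) :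
    ∃ l', Wk R X x y l' ∧ l'.length ≤ l.length ∧ ∀ l'', Wk R X x y l'' → l'.length ≤ l''.length := by
  classical
  have hex : ∃ n, ∃ l, Wk R X x y l ∧ l.length = n := ⟨_, l, h, rfl⟩
  obtain ⟨l', h', e'⟩ := Nat.find_spec hex
  refine ⟨l', h', ?_, fun l'' h'' => ?_⟩
  · rw [e']; exact Nat.find_min' hex ⟨l, h, rfl⟩
  · rw [e']; exact Nat.find_min' hex ⟨l'', h'', rfl⟩

/-- If two positions `i < j` in a minimal walk have common neighbour in `X`, `j ≤ i+2`; also nodup. -/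
lemma Wk.min_nodup {X : Finset V} {x y : V} {l : List V} (h : Wk R X x y l)
    (hmin : ∀ l'', Wk R X x y l'' → l.length ≤ l''.length) : l.Nodup := by
  rw [List.nodup_iff_sublist]
  intro a ha
  obtain ⟨A, B, e, h1, h2⟩ := List.cons_sublist_iff.1 ha
  obtain ⟨A1, A2, rfl⟩ := List.append_of_mem h1
  obtain ⟨B1, B2, rfl⟩ := List.append_of_mem (List.singleton_sublist.1 h2)
  subst e
  have w1 := h.2.2.2
  have hw : Wk R X x y (A1 ++ a :: B2) := by
    have hp : Wk R X x a (A1 ++ [a]) := by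
      have h' := h; simp only [List.append_assoc, List.cons_append] at h'
      exact h'.pre
    have hs : Wk R X a y (a :: B2) := by
      have h' : Wk R X x y ((A1 ++ a :: A2 ++ B1) ++ a :: B2) := by simpa using h
      exact h'.suf
    refine ⟨?_, ?_, ?_, ?_⟩
    · exact List.isChain_split.2 ⟨hp.1, hs.1⟩
    · have := hp.2.1
      cases A1 <;> simpa using this
    · rw [List.getLast?_append, hs.2.2.1]; rfl
    · intro v hv
      apply w1
      simp at hv ⊢; tauto
  have := hmin _ hw
  simp at this; omega

lemma Wk.min_far {X : Finset V} {x y : V} {l : List V} {u : ℕ → V} (h : Wk R X x y l) (hu : Enum l u)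
    (hmin : ∀ l'', Wk R X x y l'' → l.length ≤ l''.length) {i j : ℕ} (hij : i + 3 ≤ j) (hj : j < l.length)
    {w : V} (hw : w ∈ X) (h1 : R.Adj (u i) w) (h2 : R.Adj (u j) w) : False := by
  obtain ⟨A, E, e, hA, -, -, -⟩ := hu.split (i := i) (by omega)
  obtain ⟨A', E', e', hA', -, -, -⟩ := hu.split (i := j) hj
  have hp : Wk R X x (u i) (A ++ [u i]) := by rw [e] at h; exact h.pre
  have hs : Wk R X (u j) y (u j :: E') := by rw [e'] at h; exact h.suf
  have := hmin _ ((hp.join (Wk.single hw) h1).join hs h2.symm)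
  have := congrArg List.length e'
  simp at *; omega

variable [DecidableEq V] [DecidableRel R.Adj]

def Conn (R : SimpleGraph V) (X : Finset V) : Prop :=
  X.Nonempty ∧ ∀ P ⊆ X, P.Nonempty → P ≠ X → ∃ a ∈ P, ∃ b ∈ X \ P, R.Adj a b

def nb (R : SimpleGraph V) [DecidableRel R.Adj] (X : Finset V) (v : V) : Finset V := X.filter (R.Adj v)

lemma mem_nb {X : Finset V} {v w : V} : w ∈ nb R X v ↔ w ∈ X ∧ R.Adj v w := Finset.mem_filter

def MD (R : SimpleGraph V) [DecidableRel R.Adj] (X : Finset V) (d : ℕ) : Prop :=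
  ∀ v ∈ X, d ≤ (nb R X v).card

lemma Conn.walk {X : Finset V} (h : Conn R X) {x y : V} (hx : x ∈ X) (hy : y ∈ X) : ∃ l, Wk R X x y l := by
  classical
  by_contra hno
  set P := X.filter (fun v => ∃ l, Wk R X x v l) with hP
  have hxP : x ∈ P := by rw [hP, Finset.mem_filter]; exact ⟨hx, [x], Wk.single hx⟩
  have hyP : y ∉ P := by rw [hP, Finset.mem_filter]; tauto
  obtain ⟨a, ha, b, hb, hab⟩ := h.2 P (Finset.filter_subset _ _) ⟨x, hxP⟩ (by rintro h; rw [h] at hyP; exact hyP hy)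
  rw [hP, Finset.mem_filter] at ha
  obtain ⟨_, l, hl⟩ := ha
  rw [Finset.mem_sdiff] at hb
  exact hb.2 (Finset.mem_filter.2 ⟨hb.1, _, hl.join (Wk.single hb.1) hab⟩)

lemma Conn.path {X : Finset V} (h : Conn R X) {x y : V} (hx : x ∈ X) (hy : y ∈ X) : ∃ l, Pth R X x y l := by
  obtain ⟨l, hl⟩ := h.walk hx hy
  obtain ⟨l', h1, -, h2⟩ := hl.min
  exact ⟨l', h1.min_nodup h2, h1⟩

lemma Conn.of_walk {X : Finset V} {x : V} (hx : x ∈ X) (h : ∀ y ∈ X, ∃ l, Wk R X x y l) : Conn R X := by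
  refine ⟨⟨x, hx⟩, fun P hPX hPne hPX' => ?_⟩
  -- a chain from inside to outside has a crossing
  have cross : ∀ (Q : Finset V) (l : List V) (a b : V), Wk R X a b l → a ∈ Q → b ∉ Q → ∃ c ∈ Q, ∃ d ∉ Q, d ∈ X ∧ R.Adj c d := by
    intro Q l
    induction l with
    | nil => intro a b h; simp [Wk] at h
    | cons c l ih =>
      intro a b h ha hb
      have hc : c = a := by simpa using h.2.1
      subst hc
      rcases l with _ | ⟨d, l⟩
      · have := h.2.2.1; simp at this; subst this; exact absurd ha hb
      · have hcd : R.Adj c d := by have := h.1; simp at this; exact this.1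
        have hs : Wk R X d b (d :: l) := by have h' : Wk R X c b ([c] ++ d :: l) := h; exact h'.suf
        by_cases hd : d ∈ Q
        · exact ih d b hs hd hb
        · exact ⟨c, ha, d, hd, h.2.2.2 d (by simp), hcd⟩
  obtain ⟨a, ha⟩ := hPne
  obtain ⟨b, hb, hbP⟩ : ∃ b ∈ X, b ∉ P := by
    by_contra hno; push Not at hno
    exact hPX' (Finset.Subset.antisymm hPX hno)
  obtain ⟨la, hla⟩ := h a (hPX ha)
  obtain ⟨lb, hlb⟩ := h b hb
  by_cases hxP : x ∈ P
  · obtain ⟨c, hc, d, hd, hdX, hcd⟩ := cross P lb x b hlb hxP hbP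
    exact ⟨c, hc, d, by simp [hd, hdX], hcd⟩
  · obtain ⟨c, hc, d, hd, hdX, hcd⟩ := cross P _ a x hla.rev ha hxP
    exact ⟨c, hc, d, by simp [hd, hdX], hcd⟩

lemma short_path {X : Finset V} (h : Conn R X) {x y : V} (hx : x ∈ X) (hy : y ∈ X) {d : ℕ} (hd : MD R X d) :
    ∃ l, Pth R X x y l ∧ (l.length / 3) * d ≤ X.card := by
  obtain ⟨l0, hl0⟩ := h.walk hx hy
  obtain ⟨l, h1, -, h2⟩ := hl0.min
  refine ⟨l, ⟨h1.min_nodup h2, h1⟩, ?_⟩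
  obtain ⟨u, hu⟩ := exists_enum l h1.ne_nil
  have hmem : ∀ i < l.length, u i ∈ X := fun i hi => h1.2.2.2 _ (hu.split_mem.2 ⟨i, hi, rfl⟩)
  have hdis : ((Finset.range (l.length / 3)) : Set ℕ).PairwiseDisjoint (fun i => nb R X (u (3 * i))) := by
    intro i hi j hj hij
    simp at hi hj
    rw [Function.onFun, Finset.disjoint_left]
    intro w hw hw'
    rw [mem_nb] at hw hw'
    rcases Nat.lt_or_gt_of_ne hij with hlt | hlt
    · exact h1.min_far hu h2 (i := 3 * i) (j := 3 * j) (by omega) (by omega) hw.1 hw.2 hw'.2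
    · exact h1.min_far hu h2 (i := 3 * j) (j := 3 * i) (by omega) (by omega) hw.1 hw'.2 hw.2
  calc (l.length / 3) * d = ∑ i ∈ Finset.range (l.length / 3), d := by simp
    _ ≤ ∑ i ∈ Finset.range (l.length / 3), (nb R X (u (3 * i))).card := by
      refine Finset.sum_le_sum fun i hi => hd _ (hmem _ ?_)
      simp at hi; omega
    _ = _ := (Finset.card_biUnion hdis).symm
    _ ≤ X.card := Finset.card_le_card (by
      intro w hw
      simp only [Finset.mem_biUnion] at hw
      obtain ⟨i, -, hi⟩ := hw
      exact (mem_nb.1 hi).1)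

end Part5

set_option linter.unusedSectionVars false

section Part6
variable {V : Type*} {R : SimpleGraph V} [DecidableEq V] [DecidableRel R.Adj]

def KC (R : SimpleGraph V) (κ : ℕ) (Q : Finset V) : Prop := ∀ B : Finset V, B.card ≤ κ → Conn R (Q \ B)

lemma MD.sdiff {Q : Finset V} {d : ℕ} (h : MD R Q d) (B : Finset V) : MD R (Q \ B) (d - B.card) := by
  intro v hv
  have h1 := h v (Finset.mem_sdiff.1 hv).1
  have : nb R Q v ⊆ nb R (Q \ B) v ∪ B := by
    intro w hw
    rw [Finset.mem_union, mem_nb, Finset.mem_sdiff]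
    rw [mem_nb] at hw
    tauto
  have := (Finset.card_le_card this).trans (Finset.card_union_le _ _)
  omega

lemma MD.mono {Q : Finset V} {d d' : ℕ} (h : MD R Q d) (hd : d' ≤ d) : MD R Q d' :=
  fun v hv => hd.trans (h v hv)

lemma KC.sdiff {Q : Finset V} {κ κ' : ℕ} (h : KC R κ Q) {B : Finset V} (hB : B.card + κ' ≤ κ) : KC R κ' (Q \ B) := by
  intro B' hB'
  rw [sdiff_sdiff]
  exact h _ ((Finset.card_union_le _ _).trans (by omega))

lemma sp {Q B : Finset V} {N d : ℕ} (hN : 5 ≤ N) (hd : MD R Q d) (hQ : Q.card ≤ 4 * N * d) (hB : 2 * B.card < d)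
    (hc : Conn R (Q \ B)) {x y : V} (hx : x ∈ Q \ B) (hy : y ∈ Q \ B) :
    ∃ l, Pth R (Q \ B) x y l ∧ l.length ≤ 25 * N := by
  obtain ⟨l, h1, h2⟩ := short_path hc hx hy (hd.sdiff B)
  refine ⟨l, h1, ?_⟩
  have h3 : (Q \ B).card ≤ Q.card := Finset.card_le_card Finset.sdiff_subset
  have h4 : 4 * N * d ≤ 8 * N * (d - B.card) := by
    have : d ≤ 2 * (d - B.card) := by omega
    calc 4 * N * d ≤ 4 * N * (2 * (d - B.card)) := by gcongr
      _ = _ := by ring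
  have h5 : l.length / 3 ≤ 8 * N := by
    by_contra hc
    push Not at hc
    have : (8 * N + 1) * (d - B.card) ≤ (l.length / 3) * (d - B.card) := Nat.mul_le_mul_right _ hc
    have h6 : 0 < d - B.card := by omega
    nlinarith
  omega

lemma hub {Q B : Finset V} {N d : ℕ} (hN : 5 ≤ N) (hd : MD R Q d) (hQ : Q.card ≤ 4 * N * d) (hB : 2 * B.card < d)
    (hc : Conn R (Q \ B)) {x : V} (hx : x ∈ Q \ B) :
    ∃ A ⊆ Q \ B, x ∈ A ∧ A.card ≤ 1601 * N ^ 3 ∧ (∀ a ∈ A, ∃ l, Pth R A x a l) ∧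
      2 * (Q.filter (fun u => ∀ a ∈ A, ¬ R.Adj a u)).card ≤ d := by
  classical
  have hdpos : 0 < d := by omega
  let ND : Finset V → Finset V := fun D => Q.filter (fun u => ∃ v ∈ D, R.Adj v u)
  obtain ⟨D, hD, hmax⟩ := Finset.exists_max_image
    ((Q \ B).powerset.filter (fun D => d * D.card ≤ 16 * N * (ND D).card)) Finset.card ⟨∅, by simp⟩
  rw [Finset.mem_filter, Finset.mem_powerset] at hD
  obtain ⟨hDQ, hD⟩ := hD
  have hNDQ : (ND D).card ≤ Q.card := Finset.card_le_card (Finset.filter_subset _ _)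
  have hDc : D.card ≤ 64 * N ^ 2 := by
    have : d * D.card ≤ d * (64 * N ^ 2) := by
      calc d * D.card ≤ 16 * N * (4 * N * d) := hD.trans (by gcongr; exact hNDQ.trans hQ)
        _ = _ := by ring
    exact Nat.le_of_mul_le_mul_left this hdpos
  set U := Q \ ND D with hU
  have hUv : ∀ v ∈ Q \ B, 16 * N * (nb R U v).card ≤ d := by
    intro v hv
    by_cases hvD : v ∈ D
    · have : nb R U v = ∅ := by
        rw [Finset.eq_empty_iff_forall_notMem]
        intro w hw
        rw [mem_nb, hU, Finset.mem_sdiff] at hw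
        exact hw.1.2 (Finset.mem_filter.2 ⟨hw.1.1, v, hvD, hw.2⟩)
      simp [this]
    · by_contra hcon
      push Not at hcon
      have hins : insert v D ∈ ((Q \ B).powerset.filter (fun D => d * D.card ≤ 16 * N * (ND D).card)) := by
        rw [Finset.mem_filter, Finset.mem_powerset]
        refine ⟨Finset.insert_subset hv hDQ, ?_⟩
        rw [Finset.card_insert_of_notMem hvD]
        have hdj : Disjoint (ND D) (nb R U v) := by
          rw [Finset.disjoint_left]
          intro w h1 h2
          rw [mem_nb, hU, Finset.mem_sdiff] at h2
          exact h2.1.2 h1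
        have hsub : ND D ∪ nb R U v ⊆ ND (insert v D) := by
          intro w hw
          rw [Finset.mem_union] at hw
          rcases hw with hw | hw
          · obtain ⟨h1, z, h2, h3⟩ := Finset.mem_filter.1 hw
            exact Finset.mem_filter.2 ⟨h1, z, by simp [h2], h3⟩
          · rw [mem_nb, hU, Finset.mem_sdiff] at hw
            exact Finset.mem_filter.2 ⟨hw.1.1, v, by simp, hw.2⟩
        have := Finset.card_le_card hsub
        rw [Finset.card_union_of_disjoint hdj] at this
        calc d * (D.card + 1) = d * D.card + d := by ring
          _ ≤ 16 * N * (ND D).card + 16 * N * (nb R U v).card := by omega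
          _ = 16 * N * ((ND D).card + (nb R U v).card) := by ring
          _ ≤ _ := by gcongr
      have := hmax _ hins
      rw [Finset.card_insert_of_notMem hvD] at this
      omega
  have hUc : 2 * U.card ≤ d := by
    have e1 : ∀ u ∈ U, d - B.card ≤ (nb R (Q \ B) u).card := by
      intro u hu
      have hu' := hd u (Finset.mem_sdiff.1 hu).1
      have : nb R Q u ⊆ nb R (Q \ B) u ∪ B := by
        intro w hw
        rw [Finset.mem_union, mem_nb, Finset.mem_sdiff]
        rw [mem_nb] at hw
        tauto
      have := (Finset.card_le_card this).trans (Finset.card_union_le _ _)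
      omega
    have e2 : ∑ u ∈ U, (nb R (Q \ B) u).card = ∑ v ∈ Q \ B, (nb R U v).card := by
      simp only [nb, Finset.card_filter]
      rw [Finset.sum_comm]
      simp only [SimpleGraph.adj_comm]
    have e3 : U.card * (d - B.card) ≤ ∑ v ∈ Q \ B, (nb R U v).card := by
      rw [← e2, ← smul_eq_mul, ← Finset.sum_const]
      exact Finset.sum_le_sum e1
    have e4 : 16 * N * ∑ v ∈ Q \ B, (nb R U v).card ≤ (4 * N * d) * d := by
      rw [Finset.mul_sum]
      refine (Finset.sum_le_sum hUv).trans ?_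
      rw [Finset.sum_const, smul_eq_mul]
      gcongr
      exact (Finset.card_le_card Finset.sdiff_subset).trans hQ
    have e5 : 16 * N * (U.card * (d - B.card)) ≤ (4 * N * d) * d := (Nat.mul_le_mul_left _ e3).trans e4
    have e6 : 4 * N * (4 * (U.card * (d - B.card))) ≤ 4 * N * (d * d) := by
      calc _ = 16 * N * (U.card * (d - B.card)) := by ring
        _ ≤ _ := e5
        _ = _ := by ring
    have e7 := Nat.le_of_mul_le_mul_left e6 (by omega)
    have e8 : d ≤ 2 * (d - B.card) := by omega
    have e9 : 2 * U.card * d ≤ d * d := by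
      calc 2 * U.card * d ≤ 2 * U.card * (2 * (d - B.card)) := by gcongr
        _ = 4 * (U.card * (d - B.card)) := by ring
        _ ≤ _ := e7
    exact Nat.le_of_mul_le_mul_right e9 hdpos
  -- paths
  have hp : ∀ v, ∃ l, v ∈ D → Pth R (Q \ B) x v l ∧ l.length ≤ 25 * N := by
    intro v
    by_cases hv : v ∈ D
    · obtain ⟨l, hl⟩ := sp hN hd hQ hB hc hx (hDQ hv)
      exact ⟨l, fun _ => hl⟩
    · exact ⟨[], fun h => absurd h hv⟩
  choose l hl using hp
  refine ⟨insert x (D.biUnion fun v => (l v).toFinset), ?_, by simp, ?_, ?_, ?_⟩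
  · refine Finset.insert_subset hx ?_
    intro w hw
    simp only [Finset.mem_biUnion, List.mem_toFinset] at hw
    obtain ⟨v, hv, hw⟩ := hw
    exact (hl v hv).1.2.2.2.2 w hw
  · refine (Finset.card_insert_le _ _).trans ?_
    have : (D.biUnion fun v => (l v).toFinset).card ≤ D.card * (25 * N) :=
      Finset.card_biUnion_le_card_mul _ _ _ (fun v hv => (List.toFinset_card_le _).trans (hl v hv).2)
    have h2 : D.card * (25 * N) ≤ 64 * N ^ 2 * (25 * N) := by gcongr
    have : 64 * N ^ 2 * (25 * N) = 1600 * N ^ 3 := by ring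
    have : 1 ≤ N ^ 3 := Nat.one_le_pow _ _ (by omega)
    omega
  · intro a ha
    rw [Finset.mem_insert] at ha
    rcases ha with rfl | ha
    · exact ⟨[a], Pth.single (by simp)⟩
    · simp only [Finset.mem_biUnion, List.mem_toFinset] at ha
      obtain ⟨v, hv, ha⟩ := ha
      have hlv := (hl v hv).1
      have hin : ∀ w ∈ l v, w ∈ insert x (D.biUnion fun v => (l v).toFinset) := by
        intro w hw
        simp only [Finset.mem_insert, Finset.mem_biUnion, List.mem_toFinset]
        exact Or.inr ⟨v, hv, hw⟩
      have hlv' : Pth R (insert x (D.biUnion fun v => (l v).toFinset)) x v (l v) :=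
        ⟨hlv.1, hlv.2.1, hlv.2.2.1, hlv.2.2.2.1, hin⟩
      obtain ⟨s, t, hst⟩ := List.append_of_mem ha
      rw [hst] at hlv'
      exact ⟨_, hlv'.pre⟩
  · refine le_trans ?_ hUc
    gcongr
    intro u hu
    rw [Finset.mem_filter] at hu
    rw [hU, Finset.mem_sdiff]
    refine ⟨hu.1, fun h => ?_⟩
    obtain ⟨_, v, hv, huv⟩ := Finset.mem_filter.1 h
    refine hu.2 v ?_ huv
    simp only [Finset.mem_insert, Finset.mem_biUnion, List.mem_toFinset]
    exact Or.inr ⟨v, hv, (hl v hv).1.2.right_mem⟩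

/-! longest paths -/
def IsP (R : SimpleGraph V) (X : Finset V) (l : List V) : Prop :=
  l.Nodup ∧ l.IsChain R.Adj ∧ ∀ v ∈ l, v ∈ X

def LP (R : SimpleGraph V) (X : Finset V) (l : List V) : Prop :=
  IsP R X l ∧ ∀ l', IsP R X l' → l'.length ≤ l.length

lemma IsP.length_le {X : Finset V} {l : List V} (h : IsP R X l) : l.length ≤ X.card := by
  rw [← List.toFinset_card_of_nodup h.1]
  exact Finset.card_le_card fun v hv => h.2.2 v (List.mem_toFinset.1 hv)

lemma exists_LP (X : Finset V) : ∃ l, LP R X l := by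
  classical
  have h0 : ∃ n, ∃ l, IsP R X l ∧ l.length = n := ⟨0, [], ⟨by simp, by simp, by simp⟩, rfl⟩
  have hb : ∀ n, (∃ l, IsP R X l ∧ l.length = n) → n ≤ X.card := by
    rintro n ⟨l, hl, rfl⟩; exact hl.length_le
  obtain ⟨n0, hn0⟩ := h0
  have hg := Nat.findGreatest_spec (P := fun n => ∃ l, IsP R X l ∧ l.length = n) (hb _ hn0) hn0
  obtain ⟨l, hl, e⟩ := hg
  refine ⟨l, hl, fun l' hl' => ?_⟩
  rw [e]
  exact Nat.le_findGreatest hl'.length_le ⟨l', hl', rfl⟩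

lemma IsP.rev {X : Finset V} {l : List V} (h : IsP R X l) : IsP R X l.reverse :=
  ⟨by simpa using h.1, isChain_rev h.2.1, by simpa using h.2.2⟩

lemma LP.rev {X : Finset V} {l : List V} (h : LP R X l) : LP R X l.reverse :=
  ⟨h.1.rev, by simpa using h.2⟩

lemma LP.ne_nil {X : Finset V} {l : List V} (h : LP R X l) (hX : X.Nonempty) : l ≠ [] := by
  obtain ⟨x, hx⟩ := hX
  have := h.2 [x] ⟨by simp, by simp, by simpa using hx⟩
  rintro rfl; simp at this

lemma LP.nb_head {X : Finset V} {l : List V} {p w : V} (h : LP R X l) (hp : l.head? = some p)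
    (hw : w ∈ nb R X p) : w ∈ l := by
  by_contra hwl
  rw [mem_nb] at hw
  have := h.2 (w :: l) ⟨by simp [hwl, h.1.1], by
    rw [List.isChain_cons]; refine ⟨?_, h.1.2.1⟩
    intro y hy; rw [hp] at hy; simp at hy; subst hy; exact hw.2.symm, by
    intro v hv; simp at hv; rcases hv with rfl | hv
    · exact hw.1
    · exact h.1.2.2 v hv⟩
  simp at this

/-- number of `i` such that head is adjacent to `u (i+1)` -/
lemma LP.count_head {X : Finset V} {l : List V} {u : ℕ → V} {d : ℕ} (h : LP R X l) (hu : Enum l u)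
    (hne : l ≠ []) (hd : MD R X d) :
    d ≤ ((Finset.range (l.length - 1)).filter (fun i => R.Adj (u 0) (u (i+1)))).card := by
  have hpos : 0 < l.length := List.length_pos_iff.2 hne
  have h0 : l.head? = some (u 0) := by rw [List.head?_eq_getElem?]; exact hu 0 hpos
  have h0X : u 0 ∈ X := h.1.2.2 _ (hu.split_mem.2 ⟨0, hpos, rfl⟩)
  refine (hd _ h0X).trans ?_
  refine (Finset.card_le_card (t := (((Finset.range (l.length - 1)).filter (fun i => R.Adj (u 0) (u (i+1)))).image (fun i => u (i+1)))) ?_).trans Finset.card_image_le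
  intro w hw
  obtain ⟨i, hi, rfl⟩ := hu.split_mem.1 (h.nb_head h0 hw)
  have hadj := (mem_nb.1 hw).2
  have : i ≠ 0 := by rintro rfl; exact hadj.ne rfl
  obtain ⟨j, rfl⟩ := Nat.exists_eq_succ_of_ne_zero this
  rw [Finset.mem_image]
  exact ⟨j, by simp; exact ⟨by omega, hadj⟩, rfl⟩

lemma Enum.take_drop {l : List V} {u : ℕ → V} (hu : Enum l u) {i : ℕ} (hi : i + 1 < l.length) :
    ∃ A E, l = A ++ E ∧ A.length = i + 1 ∧ A.getLast? = some (u i) ∧ E.head? = some (u (i+1)) := by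
  refine ⟨l.take (i+1), l.drop (i+1), by simp, by simp; omega, ?_, ?_⟩
  · rw [List.getLast?_take]
    have := hu i (by omega)
    simp [this]
  · rw [List.head?_drop]; exact hu _ hi

lemma LP.rot {X : Finset V} {l : List V} {d : ℕ} (h : LP R X l) (hne : l ≠ []) (hd : MD R X d)
    {S : Finset V} (hS : S.card < d) :
    ∃ l' p, LP R X l' ∧ l'.length = l.length ∧ l'.getLast? = l.getLast? ∧ l'.head? = some p ∧ p ∉ S := by
  classical
  obtain ⟨u, hu⟩ := exists_enum l hne
  have hc := h.count_head hu hne hd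
  obtain ⟨i, hi, hiS⟩ : ∃ i ∈ ((Finset.range (l.length - 1)).filter (fun i => R.Adj (u 0) (u (i+1)))), u i ∉ S := by
    by_contra hno
    push Not at hno
    have := Finset.card_le_card_of_injOn (s := ((Finset.range (l.length - 1)).filter (fun i => R.Adj (u 0) (u (i+1))))) (t := S) u hno (by
      intro a ha b hb hab
      simp at ha hb
      exact hu.inj h.1.1 (by omega) (by omega) hab)
    omega
  simp at hi
  obtain ⟨A, E, e, hA, hAl, hE⟩ := hu.take_drop (i := i) (by omega)
  have hAh : A.head? = some (u 0) := by
    have : l.head? = some (u 0) := by rw [List.head?_eq_getElem?]; exact hu 0 (by omega)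
    rw [e, List.head?_append] at this
    cases A <;> simp_all
  have hisP : IsP R X (A.reverse ++ E) := by
    have h1 := h.1
    rw [e] at h1
    obtain ⟨b1, b2, b3⟩ := h1
    refine ⟨?_, ?_, by simpa using b3⟩
    · rw [List.nodup_append] at b1 ⊢
      simpa using b1
    · rw [List.isChain_append] at b2 ⊢
      refine ⟨isChain_rev b2.1, b2.2.1, ?_⟩
      intro a ha b hb
      rw [List.getLast?_reverse, hAh] at ha
      rw [hE] at hb
      simp at ha hb
      subst ha; subst hb; exact hi.2
  refine ⟨A.reverse ++ E, u i, ⟨hisP, ?_⟩, by simp [e], ?_, ?_, hiS⟩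
  · intro l' hl'
    have := h.2 l' hl'
    rw [e] at this; simpa using this
  · rw [e, List.getLast?_append, List.getLast?_append]
    have : E ≠ [] := by rintro rfl; simp at hE
    rw [List.getLast?_eq_some_getLast this]; rfl
  · rw [List.head?_append, List.head?_reverse, hAl]; rfl

lemma LP.long {X : Finset V} {l : List V} {d : ℕ} (h : LP R X l) (hX : Conn R X) (hd : MD R X d) :
    X.card ≤ l.length ∨ 2 * d ≤ l.length := by
  classical
  by_contra hcon
  push Not at hcon
  have hne := h.ne_nil hX.1
  have hpos : 0 < l.length := List.length_pos_iff.2 hne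
  obtain ⟨u, hu⟩ := exists_enum l hne
  have hc := h.count_head hu hne hd
  have hurev : Enum l.reverse (fun i => u (l.length - 1 - i)) := by
    intro i hi
    simp at hi
    rw [List.getElem?_reverse hi]
    exact hu _ (by omega)
  have hc' := h.rev.count_head hurev (by simpa using hne) hd
  have hc2 : d ≤ ((Finset.range (l.length - 1)).filter (fun i => R.Adj (u (l.length - 1)) (u i))).card := by
    refine hc'.trans ?_
    refine Finset.card_le_card_of_injOn (fun i => l.length - 2 - i) ?_ ?_
    · intro i hi
      simp at hi ⊢
      refine ⟨by omega, ?_⟩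
      have : l.length - 2 - i = l.length - 1 - (i + 1) := by omega
      rw [this]; exact hi.2
    · intro i hi j hj hij
      simp at hi hj hij; omega
  obtain ⟨i, hi⟩ : (((Finset.range (l.length - 1)).filter (fun i => R.Adj (u 0) (u (i+1)))) ∩
      ((Finset.range (l.length - 1)).filter (fun i => R.Adj (u (l.length - 1)) (u i)))).Nonempty := by
    rw [← Finset.card_pos]
    have h1 := Finset.card_union_add_card_inter ((Finset.range (l.length - 1)).filter (fun i => R.Adj (u 0) (u (i+1))))
      ((Finset.range (l.length - 1)).filter (fun i => R.Adj (u (l.length - 1)) (u i)))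
    have h2 : (((Finset.range (l.length - 1)).filter (fun i => R.Adj (u 0) (u (i+1)))) ∪
      ((Finset.range (l.length - 1)).filter (fun i => R.Adj (u (l.length - 1)) (u i)))).card ≤ l.length - 1 := by
      calc _ ≤ (Finset.range (l.length - 1)).card := Finset.card_le_card (Finset.union_subset (Finset.filter_subset _ _) (Finset.filter_subset _ _))
        _ = _ := by simp
    omega
  simp at hi
  obtain ⟨⟨hi1, hi2⟩, -, hi3⟩ := hi
  obtain ⟨A, E, e, hA, hAl, hE⟩ := hu.take_drop (i := i) (by omega)
  have hEl : E.getLast? = some (u (l.length - 1)) := by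
    have : l.getLast? = some (u (l.length - 1)) := by rw [List.getLast?_eq_getElem?]; exact hu _ (by omega)
    rw [e, List.getLast?_append] at this
    cases E using List.reverseRecOn <;> simp_all
  have hAh : A.head? = some (u 0) := by
    have : l.head? = some (u 0) := by rw [List.head?_eq_getElem?]; exact hu 0 (by omega)
    rw [e, List.head?_append] at this
    cases A <;> simp_all
  have hisP := h.1
  -- the cyclic list A ++ E.reverse
  have hCnd : (A ++ E.reverse).Nodup := by
    have := hisP.1
    rw [e, List.nodup_append] at this
    rw [List.nodup_append]; simpa using this
  have hCA := hisP.2.1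
  rw [e, List.isChain_append] at hCA
  have hCC : (A ++ E.reverse).IsChain R.Adj := by
    rw [List.isChain_append]
    refine ⟨hCA.1, isChain_rev hCA.2.1, ?_⟩
    intro a ha b hb
    rw [List.head?_reverse, hEl] at hb
    rw [hAl] at ha
    simp at ha hb; subst ha; subst hb; exact hi3.symm
  have hCclose : R.Adj (u (i+1)) (u 0) := hi2.symm
  have hmem : ∀ v, v ∈ A ++ E.reverse ↔ v ∈ l := by intro v; rw [e]; simp
  obtain ⟨a, ha, b, hb, hab⟩ := hX.2 l.toFinset (fun v hv => hisP.2.2 v (List.mem_toFinset.1 hv)) (by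
    obtain ⟨x, hx⟩ := List.exists_mem_of_ne_nil l hne
    exact ⟨x, by simpa using hx⟩) (by
    intro heq
    have := congrArg Finset.card heq
    rw [List.toFinset_card_of_nodup hisP.1] at this
    omega)
  rw [List.mem_toFinset, ← hmem] at ha
  rw [Finset.mem_sdiff, List.mem_toFinset, ← hmem] at hb
  obtain ⟨C1, C2, hC⟩ := List.append_of_mem ha
  have hCh : (C1 ++ a :: C2).head? = some (u 0) := by
    rw [← hC, List.head?_append, hAh]; rfl
  have hCl : (C1 ++ a :: C2).getLast? = some (u (i+1)) := by
    rw [← hC, List.getLast?_append, List.getLast?_reverse, hE]; rfl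
  rw [hC] at hCnd hCC hb
  have hlenC : (C1 ++ a :: C2).length = l.length := by rw [← hC, e]; simp
  have := h.2 (b :: a :: C2 ++ C1) ⟨?_, ?_, ?_⟩
  · simp at this hlenC; omega
  · have hp : (b :: a :: C2 ++ C1).Perm (b :: (C1 ++ a :: C2)) := by
      simpa using (List.perm_append_comm (l₁ := a :: C2) (l₂ := C1))
    rw [hp.nodup_iff, List.nodup_cons]; exact ⟨hb.2, hCnd⟩
  · rw [List.isChain_append] at hCC
    have : b :: a :: C2 ++ C1 = b :: (a :: C2 ++ C1) := by simp
    rw [this, List.isChain_cons, List.isChain_append]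
    refine ⟨by simp [hab.symm], hCC.2.1, hCC.1, ?_⟩
    intro y hy z hz
    have hy' : y = u (i+1) := by
      rw [List.getLast?_append, hy] at hCl; simpa using hCl
    have hz' : z = u 0 := by
      rw [List.head?_append, hz] at hCh; simpa using hCh
    rw [hy', hz']; exact hCclose
  · intro v hv
    have : v = b ∨ v ∈ l := by
      rw [← hmem, hC]; simp at hv ⊢; tauto
    rcases this with rfl | hv
    · exact hb.1
    · exact hisP.2.2 v hv

end Part6

set_option linter.unusedSectionVars false

section Part7
variable {V : Type*} {R : SimpleGraph V} [DecidableEq V] [DecidableRel R.Adj]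

lemma Pth.isP {X : Finset V} {x y : V} {l : List V} (h : Pth R X x y l) : IsP R X l := ⟨h.1, h.2.1, h.2.2.2.2⟩

lemma long_path {Q : Finset V} {N d : ℕ} (hN : 5 ≤ N) (hd : MD R Q d) (hQ : Q.card ≤ 4 * N * d)
    (hdN : 14000 * N ^ 3 < d) (hK : KC R (7000 * N ^ 3) Q) {x y : V} (hx : x ∈ Q) (hy : y ∈ Q) (hxy : x ≠ y) :
    ∃ l, Pth R Q x y l ∧ (Q.card ≤ l.length + 7000 * N ^ 3 ∨ 2 * d ≤ l.length + 7000 * N ^ 3) := by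
  have hN3 : 1 ≤ N ^ 3 := Nat.one_le_pow _ _ (by omega)
  obtain ⟨A1, hA1, hxA1, hA1c, hA1p, hA1d⟩ := hub (B := {y}) hN hd hQ (by simp; omega) (hK _ (by simp; omega)) (x := x)
    (by simp [hx, hxy])
  have hyA1 : y ∉ A1 := fun h => by have := hA1 h; simp at this
  obtain ⟨A2, hA2, hyA2, hA2c, hA2p, hA2d⟩ := hub (B := A1) hN hd hQ (by omega) (hK _ (by omega)) (x := y)
    (by simp [hy, hyA1])
  have hUc : (A1 ∪ A2).card ≤ 3202 * N ^ 3 := (Finset.card_union_le _ _).trans (by omega)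
  set X := Q \ (A1 ∪ A2) with hX
  have hXc : Conn R X := hK _ (by omega)
  have hXd : MD R X (d - 3202 * N ^ 3) := (hd.sdiff (A1 ∪ A2)).mono (by omega)
  have hXQ : X ⊆ Q := Finset.sdiff_subset
  obtain ⟨l0, hl0⟩ := exists_LP (R := R) X
  have hl0l := hl0.long hXc hXd
  obtain ⟨l1, p, hl1, e1, -, hp1, hpS⟩ := hl0.rot (hl0.ne_nil hXc.1) hXd
    (S := Q.filter (fun u => ∀ a ∈ A1, ¬ R.Adj a u)) (by omega)
  obtain ⟨l2, q, hl2, e2, e2', hq1, hqS⟩ := hl1.rev.rot (hl1.rev.ne_nil hXc.1) hXd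
    (S := Q.filter (fun u => ∀ a ∈ A2, ¬ R.Adj a u)) (by omega)
  rw [List.getLast?_reverse, hp1] at e2'
  have hpth : Pth R X q p l2 := ⟨hl2.1.1, hl2.1.2.1, hq1, e2', hl2.1.2.2⟩
  have hpX : p ∈ X := hl2.1.2.2 p hpth.2.right_mem
  have hqX : q ∈ X := hl2.1.2.2 q hpth.2.left_mem
  obtain ⟨a1, ha1, hap⟩ : ∃ a ∈ A1, R.Adj a p := by
    by_contra hno; push Not at hno
    exact hpS (Finset.mem_filter.2 ⟨hXQ hpX, hno⟩)
  obtain ⟨a2, ha2, haq⟩ : ∃ a ∈ A2, R.Adj a q := by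
    by_contra hno; push Not at hno
    exact hqS (Finset.mem_filter.2 ⟨hXQ hqX, hno⟩)
  obtain ⟨m1, hm1⟩ := hA1p a1 ha1
  obtain ⟨m2, hm2⟩ := hA2p a2 ha2
  have hA1Q : A1 ⊆ Q := hA1.trans Finset.sdiff_subset
  have hA2Q : A2 ⊆ Q := hA2.trans Finset.sdiff_subset
  have hd1 : ∀ v ∈ m1, v ∈ A1 := hm1.2.2.2.2
  have hd2 : ∀ v ∈ m2, v ∈ A2 := hm2.2.2.2.2
  have hd3 : ∀ v ∈ l2, v ∉ A1 ∧ v ∉ A2 := by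
    intro v hv
    have := hl2.1.2.2 v hv
    rw [hX, Finset.mem_sdiff, Finset.mem_union] at this
    tauto
  have hd4 : ∀ v ∈ A2, v ∉ A1 := fun v hv => (Finset.mem_sdiff.1 (hA2 hv)).2
  refine ⟨m1 ++ (l2.reverse ++ m2.reverse), ?_, ?_⟩
  · refine (hm1.mono hA1Q).join (((hpth.rev).mono hXQ).join (hm2.rev.mono hA2Q) haq.symm ?_) hap ?_
    · intro v hv hv2
      simp at hv hv2
      exact (hd3 v hv).2 (hd2 v hv2)
    · intro v hv hv2
      simp at hv2
      rcases hv2 with hv2 | hv2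
      · exact (hd3 v hv2).1 (hd1 v hv)
      · exact hd4 v (hd2 v hv2) (hd1 v hv)
  · have hXcard : Q.card ≤ X.card + (A1 ∪ A2).card := by
      have := Finset.le_card_sdiff (A1 ∪ A2) Q
      rw [← hX] at this
      omega
    simp at e1 e2 ⊢
    omega

lemma long_path' {Q : Finset V} {N d : ℕ} (hN : 5 ≤ N) (hd : MD R Q d) (hQ : Q.card ≤ 4 * N * d)
    (hdN : 14000 * N ^ 3 < d) (hK : KC R (7000 * N ^ 3) Q) {x y : V} (hx : x ∈ Q) (hy : y ∈ Q) (hxy : x ≠ y) :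
    ∃ l, Pth R Q x y l ∧ d ≤ l.length + 7000 * N ^ 3 := by
  obtain ⟨l, h1, h2⟩ := long_path hN hd hQ hdN hK hx hy hxy
  have h3 := hd x hx
  have h4 : (nb R Q x).card ≤ Q.card := Finset.card_le_card (Finset.filter_subset _ _)
  exact ⟨l, h1, by omega⟩

/-- closed odd walk contains an odd cycle -/
lemma odd_cycle {X : Finset V} : ∀ (n : ℕ) (C : List V), C.length = n → Odd C.length →
    (C ++ C.take 1).IsChain R.Adj → (∀ v ∈ C, v ∈ X) →
    ∃ O, Cyc R O ∧ Odd O.length ∧ O.length ≤ C.length ∧ ∀ v ∈ O, v ∈ X := by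
  intro n
  induction n using Nat.strong_induction_on with
  | _ n ih =>
    intro C hCn hodd hch hX
    by_cases hnd : C.Nodup
    · refine ⟨C, ⟨?_, hnd, hch⟩, hodd, le_rfl, hX⟩
      by_contra h3
      have : C.length = 1 := by obtain ⟨k, hk⟩ := hodd; omega
      obtain ⟨a, rfl⟩ := List.length_eq_one_iff.1 this
      simp at hch
    · rw [List.nodup_iff_sublist] at hnd
      push Not at hnd
      obtain ⟨a, ha⟩ := hnd
      obtain ⟨A, B, e, h1, h2⟩ := List.cons_sublist_iff.1 ha
      obtain ⟨A1, A2, rfl⟩ := List.append_of_mem h1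
      obtain ⟨B1, B2, rfl⟩ := List.append_of_mem (List.singleton_sublist.1 h2)
      have e' : C = A1 ++ a :: (A2 ++ B1) ++ a :: B2 := by rw [e]; simp
      generalize A2 ++ B1 = D at e'
      subst e'
      clear e
      have hlen : (A1 ++ a :: D ++ a :: B2).length = (a :: D).length + (A1 ++ a :: B2).length := by
        simp; omega
      rw [hlen] at hodd
      rcases Nat.even_or_odd (a :: D).length with hev | hod
      · have hod : Odd (A1 ++ a :: B2).length := by
          rw [Nat.odd_add] at hodd
          by_contra hh
          rw [Nat.not_odd_iff_even, ← hodd] at hh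
          exact (Nat.not_odd_iff_even.2 hev) hh
        obtain ⟨O, o1, o2, o3, o4⟩ := ih (A1 ++ a :: B2).length (by simp at hCn ⊢; omega) _ rfl hod (by
          have ht : (A1 ++ a :: D ++ a :: B2).take 1 = (A1 ++ a :: B2).take 1 := by cases A1 <;> simp
          rw [ht] at hch
          generalize (A1 ++ a :: B2).take 1 = T at hch ⊢
          have q1 : (A1 ++ [a]).IsChain R.Adj := hch.infix ⟨[], D ++ a :: B2 ++ T, by simp⟩
          have q2 : (a :: (B2 ++ T)).IsChain R.Adj := hch.infix ⟨A1 ++ a :: D, [], by simp⟩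
          have := List.isChain_split.2 ⟨q1, q2⟩
          simpa using this) (fun v hv => hX v (by simp at hv ⊢; tauto))
        exact ⟨O, o1, o2, by omega, o4⟩
      · obtain ⟨O, o1, o2, o3, o4⟩ := ih (a :: D).length (by simp at hCn ⊢; omega) _ rfl hod (by
          refine hch.infix ⟨A1, B2 ++ (A1 ++ a :: D ++ a :: B2).take 1, by simp⟩) (fun v hv => hX v (by simp at hv ⊢; tauto))
        exact ⟨O, o1, o2, by omega, o4⟩

def TwoCol (R : SimpleGraph V) (X : Finset V) : Prop := ∃ c : V → Bool, ∀ u ∈ X, ∀ v ∈ X, R.Adj u v → c u ≠ c v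

lemma short_odd {X : Finset V} {b : ℕ} {x : V} (hx : x ∈ X) (hp : ∀ y ∈ X, ∃ l, Pth R X x y l ∧ l.length ≤ b)
    (hnc : ¬ TwoCol R X) : ∃ O, Cyc R O ∧ Odd O.length ∧ O.length ≤ 2 * b ∧ ∀ v ∈ O, v ∈ X := by
  have hp' : ∀ y, ∃ l, y ∈ X → Pth R X x y l ∧ l.length ≤ b := by
    intro y
    by_cases hy : y ∈ X
    · obtain ⟨l, hl⟩ := hp y hy; exact ⟨l, fun _ => hl⟩
    · exact ⟨[], fun h => absurd h hy⟩
  choose P hP using hp'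
  have : ∃ u ∈ X, ∃ v ∈ X, R.Adj u v ∧ (P u).length % 2 = (P v).length % 2 := by
    by_contra hno
    push Not at hno
    refine hnc ⟨fun v => decide ((P v).length % 2 = 0), fun u hu v hv huv => ?_⟩
    have := hno u hu v hv huv
    simp only [ne_eq, decide_eq_decide]; omega
  obtain ⟨u, hu, v, hv, huv, hpar⟩ := this
  obtain ⟨hPu, hbu⟩ := hP u hu
  obtain ⟨hPv, hbv⟩ := hP v hv
  -- P v = x :: T ; C = P u ++ T.reverse
  obtain ⟨T, hT⟩ : ∃ T, P v = x :: T := by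
    have := hPv.2.2.1
    rcases h : P v with _ | ⟨z, T⟩
    · rw [h] at this; simp at this
    · rw [h] at this; simp at this; exact ⟨T, by rw [this]⟩
  obtain ⟨S, hS⟩ : ∃ S, P u = x :: S := by
    have := hPu.2.2.1
    rcases h : P u with _ | ⟨z, T⟩
    · rw [h] at this; simp at this
    · rw [h] at this; simp at this; exact ⟨T, by rw [this]⟩
  have hj := hPu.2.join hPv.2.rev huv
  have hl : (P u ++ T.reverse).length = (P u).length + (P v).length - 1 := by rw [hT]; simp
  have hupos : 0 < (P u).length := by rw [hS]; simp
  have hvpos : 0 < (P v).length := by rw [hT]; simp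
  obtain ⟨O, o1, o2, o3, o4⟩ := odd_cycle (R := R) (X := X) _ (P u ++ T.reverse) rfl (by
    rw [hl, Nat.odd_iff]; omega) (by
    have := hj.1
    have e : (P u ++ T.reverse) ++ (P u ++ T.reverse).take 1 = P u ++ (P v).reverse := by
      rw [hT, hS]; simp
    rw [e]; exact this) (by
    intro w hw
    apply hj.2.2.2
    rw [hT]; simp at hw ⊢; tauto)
  exact ⟨O, o1, o2, by omega, o4⟩

lemma first_hit (l : List V) (S : Finset V) (h : ∃ v ∈ l, v ∈ S) :
    ∃ A o E, l = A ++ o :: E ∧ o ∈ S ∧ ∀ v ∈ A, v ∉ S := by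
  induction l with
  | nil => simp at h
  | cons a l ih =>
    by_cases ha : a ∈ S
    · exact ⟨[], a, l, by simp, ha, by simp⟩
    · obtain ⟨A, o, E, rfl, h2, h3⟩ := ih (by simpa [ha] using h)
      exact ⟨a :: A, o, E, by simp, h2, by simpa [ha] using h3⟩

lemma Cyc.rotate {A E : List V} {o : V} (h : Cyc R (A ++ o :: E)) : Cyc R (o :: E ++ A) := by
  obtain ⟨h1, h2, h3⟩ := h
  refine ⟨by simp at h1 ⊢; omega, ?_, ?_⟩
  · exact (List.perm_append_comm (l₁ := o :: E) (l₂ := A)).nodup_iff.2 h2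
  · rcases A with _ | ⟨a, A⟩
    · simpa using h3
    · have q1 : (o :: E ++ [a]).IsChain R.Adj := h3.infix ⟨a :: A, [], by simp⟩
      have q2 : (a :: (A ++ [o])).IsChain R.Adj := h3.infix ⟨[], E ++ [a], by simp⟩
      have := List.isChain_split.2 ⟨q1, q2⟩
      simpa using this

lemma long_path_parity {Q : Finset V} {N d : ℕ} (hN : 5 ≤ N) (hd : MD R Q (d + 75 * N)) (hQ : Q.card ≤ 4 * N * d)
    (hdN : 14000 * N ^ 3 < d) (hK : KC R (8000 * N ^ 3) Q) (hnc : ∀ B : Finset V, B.card ≤ 100 * N → ¬ TwoCol R (Q \ B))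
    {x y : V} (hx : x ∈ Q) (hy : y ∈ Q) (hxy : x ≠ y) (r : ℕ) (hr : r < 2) :
    ∃ l, Pth R Q x y l ∧ d ≤ l.length + 7000 * N ^ 3 ∧ l.length % 2 = r := by
  have hN3 : 25 * N ≤ N ^ 3 := by
    calc 25 * N = 5 * 5 * N := by ring
      _ ≤ N * N * N := by gcongr
      _ = N ^ 3 := by ring
  have hQ' : Q.card ≤ 4 * N * (d + 75 * N) := hQ.trans (by gcongr; omega)
  -- odd cycle
  have hc0 : Conn R (Q \ {x,y}) := hK _ (Finset.card_le_two.trans (by omega))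
  obtain ⟨z, hz⟩ := hc0.1
  obtain ⟨O, hO, hOodd, hOlen, hOX⟩ := short_odd (R := R) (X := Q \ {x,y}) (b := 25 * N) hz (fun w hw =>
    sp hN hd hQ' (by have : ({x,y} : Finset V).card ≤ 2 := Finset.card_le_two
                     omega) hc0 hz hw)
    (hnc _ (Finset.card_le_two.trans (by omega)))
  have hc1 : Conn R (Q \ {y}) := hK _ (by simp; omega)
  obtain ⟨o, ho⟩ : ∃ o, o ∈ O := List.exists_mem_of_ne_nil O (by rintro rfl; have := hO.1; simp at this)
  have hOQ : ∀ v ∈ O, v ∈ Q ∧ v ≠ x ∧ v ≠ y := by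
    intro v hv
    have := hOX v hv
    simp at this; tauto
  obtain ⟨T, hT, hTl⟩ := sp hN hd hQ' (by simp; omega) hc1 (x := x) (y := o) (by simp [hx, hxy]) (by simp [hOQ o ho])
  obtain ⟨A, o1, E, hTA, ho1, hAO⟩ := first_hit T O.toFinset ⟨o, hT.2.right_mem, by simpa using ho⟩
  rw [List.mem_toFinset] at ho1
  have hAO' : ∀ v ∈ A, v ∉ O := fun v hv h => hAO v hv (List.mem_toFinset.2 h)
  rw [hTA] at hT hTl
  have hT' := hT.pre
  obtain ⟨O1, O2, hO12⟩ := List.append_of_mem ho1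
  have hrot : Cyc R (o1 :: O2 ++ O1) := (hO12 ▸ hO).rotate
  have hmemO : ∀ v, v ∈ O ↔ v ∈ o1 :: O2 ++ O1 := by intro v; rw [hO12]; simp; tauto
  have hlenO : O.length = (o1 :: O2 ++ O1).length := by rw [hO12]; simp; omega
  rw [List.cons_append] at hrot hmemO hlenO
  generalize hO' : O2 ++ O1 = O' at hrot hmemO hlenO
  rcases O' with _ | ⟨o2, O''⟩
  · have := hrot.1; simp at this
  have hOne : O'' ≠ [] := by rintro rfl; have := hrot.1; simp at this
  have hnd := hrot.2.1
  -- the removed set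
  set C := ((A ++ [o1]).toFinset ∪ O.toFinset).erase o2 with hC
  have hCc : C.card ≤ 75 * N := by
    refine (Finset.card_erase_le).trans ((Finset.card_union_le _ _).trans ?_)
    have h1 := List.toFinset_card_le (A ++ [o1])
    have h2 := List.toFinset_card_le O
    rw [List.length_append, List.length_singleton] at h1
    simp at hTl; omega
  have ho2O : o2 ∈ O := (hmemO o2).2 (by simp)
  have hTy : ∀ v ∈ A ++ [o1], v ≠ y := fun v hv h => by
    have := hT'.2.2.2.2 v hv; simp at this; exact this.2 h
  have hβ := long_path' (R := R) (Q := Q \ C) (N := N) (d := d) (x := o2) (y := y) hN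
    ((hd.sdiff C).mono (by omega)) ((Finset.card_le_card Finset.sdiff_subset).trans hQ) hdN
    (hK.sdiff (by omega)) (by simp [hC, hOQ o2 ho2O]) (by
      rw [Finset.mem_sdiff]
      refine ⟨hy, fun h => ?_⟩
      rw [hC, Finset.mem_erase, Finset.mem_union, List.mem_toFinset, List.mem_toFinset] at h
      rcases h.2 with h | h
      · exact hTy y h rfl
      · exact (hOQ y h).2.2 rfl) (hOQ o2 ho2O).2.2
  obtain ⟨β, hβ, hβl⟩ := hβ
  have hβC : ∀ v ∈ β, v ∉ C := fun v hv => (Finset.mem_sdiff.1 (hβ.2.2.2.2 v hv)).2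
  have hβ' : Pth R Q o2 y β := hβ.mono Finset.sdiff_subset
  have hTQ : Pth R Q x o1 (A ++ [o1]) := hT'.mono Finset.sdiff_subset
  have ho12 : o1 ≠ o2 := by simp at hnd; tauto
  have ho2A : o2 ∉ A ++ [o1] := by
    simp; exact ⟨fun h => hAO' _ h ho2O, ho12.symm⟩
  have hdis1 : ∀ v ∈ A ++ [o1], v ∉ β := by
    intro v hv hvβ
    refine hβC v hvβ ?_
    rw [hC, Finset.mem_erase, Finset.mem_union, List.mem_toFinset]
    exact ⟨fun h => ho2A (h ▸ hv), Or.inl hv⟩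
  have hadj12 : R.Adj o1 o2 := by have := hrot.2.2; simp at this; exact this.1
  have hp1 : Pth R Q x y ((A ++ [o1]) ++ β) := hTQ.join hβ' hadj12 hdis1
  -- the second path
  obtain ⟨w, hw⟩ : ∃ w, O''.head? = some w := ⟨_, List.head?_eq_some_head hOne⟩
  obtain ⟨z', hz'⟩ : ∃ w, O''.getLast? = some w := ⟨_, List.getLast?_eq_some_getLast hOne⟩
  have hch := hrot.2.2
  have hO''p : Pth R Q w z' O'' := by
    refine ⟨by simp at hnd; exact hnd.2.2, ?_, hw, hz', ?_⟩
    · exact hch.infix ⟨[o1,o2], [o1], by simp⟩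
    · intro v hv; exact (hOQ v ((hmemO v).2 (by simp [hv]))).1
  have hadjw : R.Adj o2 w := by
    have : (o2 :: O'').IsChain R.Adj := hch.infix ⟨[o1], [o1], by simp⟩
    rw [List.isChain_cons] at this
    exact this.1 w hw
  have hadjz : R.Adj z' o1 := by
    have : (O'' ++ [o1]).IsChain R.Adj := hch.infix ⟨[o1,o2], [], by simp⟩
    rw [List.isChain_append] at this
    exact this.2.2 z' hz' o1 (by simp)
  have hp2 : Pth R Q x y ((A ++ [o1]) ++ (O''.reverse ++ β)) := by
    refine hTQ.join (hO''p.rev.join hβ' hadjw.symm ?_) hadjz.symm ?_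
    · intro v hv hvβ
      simp at hv
      refine hβC v hvβ ?_
      rw [hC, Finset.mem_erase, Finset.mem_union, List.mem_toFinset, List.mem_toFinset]
      refine ⟨?_, Or.inr ((hmemO v).2 (by simp [hv]))⟩
      rintro rfl; simp at hnd; tauto
    · intro v hv hv2
      rw [List.mem_append] at hv2
      rcases hv2 with hv2 | hv2
      · simp at hv2
        have hvO : v ∈ O := (hmemO v).2 (by simp [hv2])
        simp at hv
        rcases hv with hv | rfl
        · exact hAO' v hv hvO
        · simp at hnd; tauto
      · exact hdis1 v hv hv2
  by_cases hpar : ((A ++ [o1]) ++ β).length % 2 = r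
  · exact ⟨_, hp1, by simp; omega, hpar⟩
  · refine ⟨_, hp2, by simp; omega, ?_⟩
    rw [Nat.odd_iff] at hOodd
    simp at hpar hOodd hlenO ⊢; omega

end Part7


section Part8
variable {V : Type*} {R : SimpleGraph V} [DecidableEq V] [DecidableRel R.Adj]

/-- two disjoint paths from `Q` to `u`, `v` -/
def TD (R : SimpleGraph V) (X Q : Finset V) (u v : V) : Prop :=
  ∃ a b p q, Pth R X a u p ∧ Pth R X b v q ∧ a ∈ Q ∧ b ∈ Q ∧ ∀ x ∈ p, x ∉ q

lemma TD.symm {X Q : Finset V} {u v : V} (h : TD R X Q u v) : TD R X Q v u := by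
  obtain ⟨a, b, p, q, h1, h2, h3, h4, h5⟩ := h
  exact ⟨b, a, q, p, h2, h1, h4, h3, fun x hx hx' => h5 x hx' hx⟩

/-- join two paths at a common vertex -/
lemma Pth.glue {X : Finset V} {x y z : V} {A E : List V} (h : Pth R X x z (A ++ [z])) (h' : Pth R X z y (z :: E))
    (hd : ∀ v ∈ E, v ∉ A ++ [z]) : Pth R X x y (A ++ z :: E) := by
  refine ⟨?_, List.isChain_split.2 ⟨h.2.1, h'.2.1⟩, ?_, ?_, ?_⟩
  · have h1 := h.1
    have h2 := h'.1
    rw [show A ++ z :: E = (A ++ [z]) ++ E by simp]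
    rw [List.nodup_append]
    refine ⟨h1, (List.nodup_cons.1 h2).2, ?_⟩
    rintro a ha b hb rfl
    exact hd a hb ha
  · have := h.2.2.1
    cases A <;> simpa using this
  · rw [List.getLast?_append, h'.2.2.2.1]; rfl
  · intro v hv
    rcases List.mem_append.1 hv with hv | hv
    · exact h.2.2.2.2 v (by simp [hv])
    · exact h'.2.2.2.2 v hv

lemma TD.step {X Q : Finset V} (hz : ∀ z, Conn R (X.erase z)) (hQX : Q ⊆ X) (hQ : 2 ≤ Q.card) {u v : V} (hu : u ∈ X)
    (hv : v ∈ X) (huv : u ≠ v) (h : u ∈ Q ∨ ∃ y, R.Adj u y ∧ TD R X Q u y) : TD R X Q u v := by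
  obtain ⟨q0, hq0, hq0u⟩ := Finset.exists_mem_ne (by omega : 1 < Q.card) u
  obtain ⟨r, hr⟩ := (hz u).path (x := q0) (y := v) (by simp [hq0u, hQX hq0]) (by simp [huv.symm, hv])
  have hru : u ∉ r := fun hh => by have := hr.2.2.2.2 u hh; simp at this
  have hr' : Pth R X q0 v r := hr.mono (Finset.erase_subset _ _)
  rcases h with h | ⟨y, huy, a, b, p, q, hp, hq, ha, hb, hd⟩
  · exact ⟨u, q0, [u], r, Pth.single hu, hr', h, hq0, by simpa using hru⟩
  obtain ⟨A, z, E, e, hzS, hA⟩ := first_hit r.reverse (p.toFinset ∪ q.toFinset ∪ Q)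
    ⟨q0, by simp; exact hr.2.left_mem, by simp [hq0]⟩
  have e' : r = E.reverse ++ z :: A.reverse := by
    rw [← List.reverse_reverse r, e]; simp
  have hA' : ∀ v ∈ A.reverse, v ∉ p ∧ v ∉ q := by
    intro w hw
    have := hA w (by simpa using hw)
    simp at this; tauto
  have hAu : u ∉ A.reverse := fun hh => hru (by rw [e']; simp at hh; simp [hh])
  have hzu : z ≠ u := by rintro rfl; exact hru (by rw [e']; simp)
  rw [e'] at hr'
  have hs := hr'.suf
  generalize A.reverse = F at hA' hAu hs
  by_cases hzq : z ∈ q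
  · obtain ⟨q1, q2, rfl⟩ := List.append_of_mem hzq
    refine ⟨a, b, p, q1 ++ z :: F, hp, hq.pre.glue hs ?_, ha, hb, ?_⟩
    · intro w hw hw'
      have := (hA' w hw).2
      simp at this hw'; tauto
    · intro w hw hw'
      have h1 := hd w hw
      have h2 := fun h => (hA' w h).1 hw
      simp at h1 hw'; tauto
  by_cases hzp : z ∈ p
  · obtain ⟨p1, p2, rfl⟩ := List.append_of_mem hzp
    refine ⟨b, a, q ++ [u], p1 ++ z :: F, hq.join (Pth.single hu) huy.symm ?_, hp.pre.glue hs ?_, hb, ha, ?_⟩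
    · intro w hw hw'
      simp at hw'; subst hw'
      exact hd w hp.2.right_mem hw
    · intro w hw hw'
      have := (hA' w hw).1
      simp at this hw'; tauto
    · have hup : u ∈ p2 := by
        have h1 := hp.suf.2.right_mem
        simp at h1
        rcases h1 with h1 | h1
        · exact absurd h1.symm hzu
        · exact h1
      intro w hw hw'
      rw [List.mem_append, List.mem_singleton] at hw
      rcases hw with hw | rfl
      · have h2 := fun h => (hA' w h).2 hw
        have h1 := fun h => hd w h hw
        simp at h1 hw'; tauto
      · have h1 := hp.1
        rw [show p1 ++ z :: p2 = (p1 ++ [z]) ++ p2 by simp, List.nodup_append] at h1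
        have h3 := h1.2.2
        rw [show p1 ++ z :: F = (p1 ++ [z]) ++ F by simp, List.mem_append] at hw'
        rcases hw' with hw' | hw'
        · exact h3 w hw' w hup rfl
        · exact hAu hw'
  · have hzQ : z ∈ Q := by simp at hzS; tauto
    refine ⟨a, z, p, z :: F, hp, hs, ha, hzQ, ?_⟩
    intro w hw hw'
    simp at hw'
    rcases hw' with rfl | hw'
    · exact hzp hw
    · exact (hA' w hw').1 hw

lemma TD.all {X Q : Finset V} (hX : Conn R X) (hz : ∀ z, Conn R (X.erase z)) (hQX : Q ⊆ X) (hQ : 2 ≤ Q.card) {u v : V} (hu : u ∈ X)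
    (hv : v ∈ X) (huv : u ≠ v) : TD R X Q u v := by
  classical
  set P := X.filter (fun u => u ∈ Q ∨ ∃ y, R.Adj u y ∧ TD R X Q u y) with hP
  have hPX : P = X := by
    by_contra hne
    obtain ⟨q, hq⟩ : Q.Nonempty := Finset.card_pos.1 (by omega)
    obtain ⟨a, ha, b, hb, hab⟩ := hX.2 P (Finset.filter_subset _ _) ⟨q, by simp [hP, hq, hQX hq]⟩ hne
    rw [Finset.mem_sdiff] at hb
    rw [hP, Finset.mem_filter] at ha
    refine hb.2 ?_
    rw [hP, Finset.mem_filter]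
    exact ⟨hb.1, Or.inr ⟨a, hab.symm, (TD.step hz hQX hQ ha.1 hb.1 hab.ne ha.2).symm⟩⟩
  have : u ∈ P := by rw [hPX]; exact hu
  rw [hP, Finset.mem_filter] at this
  exact TD.step hz hQX hQ hu hv huv this.2

lemma trim {X Q1 Q2 : Finset V} (hd : Disjoint Q1 Q2) {x y : V} {l : List V} (h : Pth R X x y l) (hx : x ∈ Q1)
    (hy : y ∈ Q2) : ∃ a b p, a ∈ Q1 ∧ b ∈ Q2 ∧ (∀ v ∈ p, v ∉ Q1 ∧ v ∉ Q2) ∧ (a :: (p ++ [b])).Nodup ∧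
      (a :: (p ++ [b])).IsChain R.Adj ∧ (∀ v ∈ a :: (p ++ [b]), v ∈ l) := by
  obtain ⟨A, b, E, e, hb, hA⟩ := first_hit l Q2 ⟨y, h.2.right_mem, hy⟩
  have hxA : x ∈ A := by
    have := h.2.2.1
    rw [e] at this
    cases A with
    | nil => simp at this; subst this; exact absurd hb (Finset.disjoint_left.1 hd hx)
    | cons c A => simp at this; simp [this]
  obtain ⟨A', a, E', e', ha, hA'⟩ := first_hit A.reverse Q1 ⟨x, by simpa using hxA, hx⟩
  have e2 : A = E'.reverse ++ a :: A'.reverse := by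
    rw [← List.reverse_reverse A, e']; simp
  have hin : (a :: (A'.reverse ++ [b])) <:+: l := ⟨E'.reverse, E, by rw [e, e2]; simp⟩
  refine ⟨a, b, A'.reverse, ha, hb, ?_, h.1.sublist hin.sublist, h.2.1.infix hin, fun v hv => hin.subset hv⟩
  intro v hv
  exact ⟨hA' v (by simpa using hv), hA v (by rw [e2]; simp at hv; simp [hv])⟩

lemma Pth.form {X : Finset V} {x y : V} {l : List V} (h : Pth R X x y l) (hxy : x ≠ y) :
    ∃ p, l = x :: (p ++ [y]) := by
  have h1 := h.2.2.1
  have h2 := h.2.2.2.1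
  cases l with
  | nil => simp at h1
  | cons c l =>
    simp at h1; subst h1
    rcases List.eq_nil_or_concat l with rfl | ⟨p, z, rfl⟩
    · simp at h2; exact absurd h2 hxy
    · rw [List.concat_eq_append] at *
      rw [← List.cons_append, List.getLast?_append] at h2
      simp at h2; subst h2; exact ⟨p, rfl⟩

lemma glue_cyc {Q1 Q2 : Finset V} (hd : Disjoint Q1 Q2) {a1 a2 b1 b2 : V} {p q al be : List V} (hab : a1 ≠ a2)
    (hbb : b1 ≠ b2) (hα : Pth R Q1 a1 a2 al) (hβ : Pth R Q2 b1 b2 be)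
    (hp : ∀ v ∈ p, v ∉ Q1 ∧ v ∉ Q2) (hq : ∀ v ∈ q, v ∉ Q1 ∧ v ∉ Q2) (hpn : (a1 :: (p ++ [b1])).Nodup)
    (hqn : (a2 :: (q ++ [b2])).Nodup) (hpc : (a1 :: (p ++ [b1])).IsChain R.Adj)
    (hqc : (a2 :: (q ++ [b2])).IsChain R.Adj) (hpq : ∀ v ∈ p, v ∉ q) :
    Cyc R (al ++ (q ++ (be.reverse ++ p.reverse))) := by
  have hda := hα.2.2.2.2
  have hdb := hβ.2.2.2.2
  have hdd : ∀ v ∈ Q1, v ∉ Q2 := fun v h => Finset.disjoint_left.1 hd h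
  have hpn' : p.Nodup := hpn.sublist (by simp)
  have hqn' : q.Nodup := hqn.sublist (by simp)
  refine ⟨?_, ?_, ?_⟩
  · obtain ⟨m1, rfl⟩ := hα.form hab
    obtain ⟨m2, rfl⟩ := hβ.form hbb
    simp; omega
  · rw [List.nodup_append, List.nodup_append, List.nodup_append]
    refine ⟨hα.1, ⟨hqn', ⟨by simpa using hβ.1, by simpa using hpn', ?_⟩, ?_⟩, ?_⟩
    · rintro v hv w hw rfl
      simp at hv hw
      exact (hp v hw).2 (hdb v hv)
    · rintro v hv w hw rfl
      simp at hw
      rcases hw with hw | hw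
      · exact (hq v hv).2 (hdb v hw)
      · exact hpq v hw hv
    · rintro v hv w hw rfl
      simp at hw
      rcases hw with hw | hw | hw
      · exact (hq v hw).1 (hda v hv)
      · exact hdd v (hda v hv) (hdb v hw)
      · exact (hp v hw).1 (hda v hv)
  · have hr := isChain_rev hpc
    have hb := isChain_rev hβ.2.1
    have ha := hα.2.1
    obtain ⟨m1, rfl⟩ := hα.form hab
    obtain ⟨m2, rfl⟩ := hβ.form hbb
    simp only [List.reverse_cons, List.reverse_append, List.reverse_nil, List.nil_append, List.cons_append, List.append_assoc, List.take_succ_cons, List.take_zero] at *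
    rw [← List.cons_append, List.isChain_split]
    refine ⟨ha, ?_⟩
    rw [← List.cons_append, List.isChain_split]
    refine ⟨hqc, ?_⟩
    rw [← List.cons_append, List.isChain_split]
    exact ⟨hb, hr⟩

lemma glue {X Q1 Q2 : Finset V} {N d : ℕ} (hX : Conn R X) (hz : ∀ z, Conn R (X.erase z)) (h1X : Q1 ⊆ X) (h2X : Q2 ⊆ X)
    (hd : Disjoint Q1 Q2) (hN : 5 ≤ N) (hd1 : MD R Q1 (d + 75 * N)) (hd2 : MD R Q2 (d + 75 * N))
    (hQ1 : Q1.card ≤ 4 * N * d) (hQ2 : Q2.card ≤ 4 * N * d)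
    (hdN : 14000 * N ^ 3 < d) (hK1 : KC R (8000 * N ^ 3) Q1) (hK2 : KC R (8000 * N ^ 3) Q2)
    (hb : ∀ B : Finset V, B.card ≤ 100 * N → ¬ TwoCol R (Q1 \ B)) (hc1 : 2 ≤ Q1.card) (hc2 : 2 ≤ Q2.card) :
    ∃ l, Cyc R l ∧ Even l.length ∧ 2 * d ≤ l.length + 14000 * N ^ 3 := by
  obtain ⟨u, hu, v, hv, huv⟩ := Finset.one_lt_card.1 (by omega : 1 < Q2.card)
  obtain ⟨x, y, p0, q0, hp, hq, hx, hy, hpq⟩ := TD.all hX hz h1X hc1 (h2X hu) (h2X hv) huv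
  obtain ⟨a1, b1, p, ha1, hb1, hp1, hpn, hpc, hpl⟩ := trim hd hp hx hu
  obtain ⟨a2, b2, q, ha2, hb2, hq1, hqn, hqc, hql⟩ := trim hd hq hy hv
  have hab : a1 ≠ a2 := by rintro rfl; exact hpq a1 (hpl _ (by simp)) (hql _ (by simp))
  have hbb : b1 ≠ b2 := by rintro rfl; exact hpq b1 (hpl _ (by simp)) (hql _ (by simp))
  obtain ⟨be, hbe, hbl⟩ := long_path' hN (hd2.mono (by omega)) hQ2 hdN (by
    have := hK2.sdiff (B := ∅) (κ' := 7000 * N ^ 3) (by simp; omega)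
    simpa using this) hb1 hb2 hbb
  obtain ⟨al, hal, hall, hpar⟩ := long_path_parity hN hd1 hQ1 hdN hK1 hb ha1 ha2 hab
    (r := (be.length + p.length + q.length) % 2) (by omega)
  refine ⟨_, glue_cyc hd hab hbb hal hbe hp1 hq1 hpn hqn hpc hqc ?_, ?_, ?_⟩
  · intro v hv hv'
    exact hpq v (hpl _ (by simp [hv])) (hql _ (by simp [hv']))
  · rw [Nat.even_iff]; simp; omega
  · simp; omega

end Part8


section Part9
variable {V : Type*} {R : SimpleGraph V} [DecidableEq V] [DecidableRel R.Adj]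

lemma alt_len (c : V → Bool) {X : Finset V} (hc : ∀ u ∈ X, ∀ v ∈ X, R.Adj u v → c u ≠ c v) :
    ∀ (l : List V) (x y : V), Wk R X x y l → (c x ≠ c y ↔ Even l.length)
  | [], x, y, h => absurd rfl h.ne_nil
  | [a], x, y, h => by
    have h1 := h.2.1
    have h2 := h.2.2.1
    simp at h1 h2
    simp [← h1, ← h2]
  | a :: b :: l, x, y, h => by
    have h1 := h.2.1
    simp at h1; subst h1
    have hab : R.Adj a b := by have := h.1; simp at this; exact this.1
    have hw : Wk R X b y (b :: l) := Wk.suf (A := [a]) h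
    have ih := alt_len c hc (b :: l) b y hw
    have hne := hc a (h.2.2.2 a (by simp)) b (h.2.2.2 b (by simp)) hab
    rw [List.length_cons, Nat.even_add_one, ← ih]
    cases h1 : c a <;> cases h2 : c b <;> cases h3 : c y <;> simp_all

lemma bip_cyc {Q B : Finset V} {N d : ℕ} (hN : 5 ≤ N) (hd : MD R Q (d + 100 * N)) (hQ : Q.card ≤ 4 * N * d)
    (hdN : 14000 * N ^ 3 < d) (hK : KC R (8000 * N ^ 3) Q) (hB : B.card ≤ 100 * N) (hc : TwoCol R (Q \ B)) :
    ∃ l, Cyc R l ∧ Even l.length ∧ 2 * d ≤ l.length + 14000 * N ^ 3 := by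
  have hN3 : 25 * N ≤ N ^ 3 := by
    calc 25 * N = 5 * 5 * N := by ring
      _ ≤ N * N * N := by gcongr
      _ = N ^ 3 := by ring
  have hXd : MD R (Q \ B) d := (hd.sdiff B).mono (by omega)
  have hXK : KC R (7000 * N ^ 3) (Q \ B) := hK.sdiff (by omega)
  have hXc : (Q \ B).card ≤ 4 * N * d := (Finset.card_le_card Finset.sdiff_subset).trans hQ
  have hXcon : Conn R (Q \ B) := by simpa using hXK ∅ (by simp)
  generalize Q \ B = X at *
  obtain ⟨c, hc⟩ := hc
  obtain ⟨x, hx⟩ := hXcon.1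
  have h0 := hXd x hx
  obtain ⟨y, hy⟩ := Finset.card_pos.1 (show 0 < (nb R X x).card by omega)
  rw [mem_nb] at hy
  have h1 := hXd y hy.1
  have hdis : Disjoint (nb R X x) (nb R X y) := by
    rw [Finset.disjoint_left]
    intro v hv hv'
    rw [mem_nb] at hv hv'
    have e1 := hc x hx v hv.1 hv.2
    have e2 := hc y hy.1 v hv'.1 hv'.2
    have e3 := hc x hx y hy.1 hy.2
    cases h1 : c x <;> cases h2 : c y <;> cases h3 : c v <;> simp_all
  have h2 : 2 * d ≤ X.card := by
    have := Finset.card_le_card (Finset.union_subset (s := nb R X x) (t := nb R X y) (u := X) (Finset.filter_subset _ _) (Finset.filter_subset _ _))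
    rw [Finset.card_union_of_disjoint hdis] at this
    omega
  obtain ⟨l, hl, hlen⟩ := long_path hN hXd hXc hdN hXK hx hy.1 hy.2.ne
  have hev := (alt_len c hc l x y hl.2).1 (hc x hx y hy.1 hy.2)
  refine ⟨l, ⟨by omega, hl.1, ?_⟩, hev, by omega⟩
  have hch := hl.2.1
  obtain ⟨p, rfl⟩ := hl.form hy.2.ne
  have : (x :: p ++ y :: [x]).IsChain R.Adj := by
    rw [List.isChain_split]
    exact ⟨by simpa using hch, by simpa using hy.2.symm⟩
  simpa using this

def IsPc (R : SimpleGraph V) [DecidableRel R.Adj] (D κ j : ℕ) (Q : Finset V) : Prop :=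
  Q.Nonempty ∧ ∀ v ∈ Q, D ≤ (nb R Q v).card + j * κ

lemma IsPc.card {D κ j : ℕ} {Q : Finset V} (h : IsPc R D κ j Q) : D ≤ Q.card + j * κ := by
  obtain ⟨x, hx⟩ := h.1
  have := h.2 x hx
  have := Finset.card_le_card (show nb R Q x ⊆ Q from Finset.filter_subset _ _)
  omega

lemma IsPc.split {D κ j : ℕ} {Q : Finset V} (h : IsPc R D κ j Q) (hK : ¬ KC R κ Q) (hD : (j + 1) * κ < D) :
    ∃ P P', P ⊆ Q ∧ P' ⊆ Q ∧ Disjoint P P' ∧ IsPc R D κ (j + 1) P ∧ IsPc R D κ (j + 1) P' := by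
  have e : (j + 1) * κ = j * κ + κ := by ring
  simp only [KC, not_forall] at hK
  obtain ⟨B, hB, hC⟩ := hK
  have hne : (Q \ B).Nonempty := by
    have := h.card
    have := Finset.le_card_sdiff B Q
    exact Finset.card_pos.1 (by omega)
  simp only [Conn, hne, true_and, not_forall] at hC
  obtain ⟨P, hP, hPn, hPX, hno⟩ := hC
  push Not at hno
  have hsub : ∀ v P', (∀ w ∈ Q, R.Adj v w → w ∈ P' ∨ w ∈ B) → v ∈ Q → D ≤ (nb R P' v).card + (j + 1) * κ := by
    intro v P' hw hv
    have h1 := h.2 v hv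
    have h2 : nb R Q v ⊆ nb R P' v ∪ B := by
      intro w hw'
      rw [mem_nb] at hw'
      rw [Finset.mem_union, mem_nb]
      rcases hw w hw'.1 hw'.2 with h | h
      · exact Or.inl ⟨h, hw'.2⟩
      · exact Or.inr h
    have h3 := (Finset.card_le_card h2).trans (Finset.card_union_le _ _)
    omega
  refine ⟨P, (Q \ B) \ P, hP.trans Finset.sdiff_subset, Finset.sdiff_subset.trans Finset.sdiff_subset,
    Finset.disjoint_sdiff, ⟨hPn, fun v hv => hsub v _ ?_ (Finset.sdiff_subset (hP hv))⟩, ⟨?_, fun v hv => hsub v _ ?_ ?_⟩⟩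
  · intro w hw hvw
    by_contra hcon
    push Not at hcon
    exact hno v hv w (by simp [hw, hcon]) hvw
  · rw [Finset.sdiff_nonempty]
    exact fun hh => hPX (hP.antisymm hh)
  · intro w hw hvw
    by_contra hcon
    push Not at hcon
    refine hno w ?_ v hv hvw.symm
    by_contra hwP
    exact hcon.1 (by simp [hw, hcon.2, hwP])
  · simp at hv; exact hv.1.1

lemma exists_piece {D κ n N : ℕ} (hn : n ≤ 2 * N * D) (hκ : 2 * ((4 * N + 1) * κ) < D) :
    ∀ (c : ℕ) (Q : Finset V) (j : ℕ), Q.card ≤ c → IsPc R D κ j Q → j * D + 2 * Q.card ≤ 2 * n →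
      ∃ Q' ⊆ Q, Q'.Nonempty ∧ MD R Q' (D - 4 * N * κ) ∧ KC R κ Q' := by
  intro c
  induction c with
  | zero => intro Q j hc h; exact absurd (Finset.card_pos.2 h.1) (by omega)
  | succ c ih =>
    intro Q j hc h hj
    have hj4 : j ≤ 4 * N := by
      have : j * D ≤ (4 * N) * D := by nlinarith
      exact Nat.le_of_mul_le_mul_right this (by omega)
    have hjk : (j + 1) * κ ≤ (4 * N + 1) * κ := by gcongr
    by_cases hK : KC R κ Q
    · refine ⟨Q, subset_rfl, h.1, fun v hv => ?_, hK⟩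
      have := h.2 v hv
      have : j * κ ≤ 4 * N * κ := by gcongr
      omega
    · obtain ⟨P, P', hP, hP', hd, h1, h2⟩ := h.split hK (by omega)
      have hc2 := h2.card
      have hun := Finset.card_le_card (Finset.union_subset hP hP')
      rw [Finset.card_union_of_disjoint hd] at hun
      obtain ⟨Q', a, b⟩ := ih P (j + 1) (by omega) h1 (by
        have : (j + 1) * D = j * D + D := by ring
        omega)
      exact ⟨Q', a.trans hP, b⟩

lemma two_pieces {D κ n N : ℕ} {Q : Finset V} (hn : n ≤ 2 * N * D) (hκ : 2 * ((4 * N + 1) * κ) < D) (hQn : Q.card ≤ n)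
    (hQ : MD R Q D) (hne : Q.Nonempty) (hK : ¬ KC R κ Q) :
    ∃ Q1 Q2, Q1 ⊆ Q ∧ Q2 ⊆ Q ∧ Disjoint Q1 Q2 ∧ Q1.Nonempty ∧ Q2.Nonempty ∧ MD R Q1 (D - 4 * N * κ) ∧
      MD R Q2 (D - 4 * N * κ) ∧ KC R κ Q1 ∧ KC R κ Q2 := by
  have h : IsPc R D κ 0 Q := ⟨hne, fun v hv => by have := hQ v hv; omega⟩
  have hk : κ ≤ (4 * N + 1) * κ := by nlinarith [Nat.zero_le (N * κ)]
  obtain ⟨P, P', hP, hP', hd, h1, h2⟩ := h.split hK (by omega)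
  have hc1 := h1.card
  have hc2 := h2.card
  have hun := Finset.card_le_card (Finset.union_subset hP hP')
  rw [Finset.card_union_of_disjoint hd] at hun
  obtain ⟨Q1, a1, b1, c1, d1⟩ := exists_piece hn hκ _ P _ le_rfl h1 (by omega)
  obtain ⟨Q2, a2, b2, c2, d2⟩ := exists_piece hn hκ _ P' _ le_rfl h2 (by omega)
  exact ⟨Q1, Q2, a1.trans hP, a2.trans hP', Disjoint.mono a1 a2 hd, b1, b2, c1, c2, d1, d2⟩

end Part9


section Part10
variable {V : Type*} {R : SimpleGraph V} [DecidableEq V] [DecidableRel R.Adj]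

lemma conn_of_induce {A : Finset V} (h : (R.induce (A : Set V)).Connected) : Conn R A := by
  refine ⟨?_, ?_⟩
  · obtain ⟨x⟩ := h.nonempty
    exact ⟨x.1, x.2⟩
  · intro P hP hPn hPA
    obtain ⟨a, ha⟩ := hPn
    obtain ⟨b, hb, hbP⟩ : ∃ b ∈ A, b ∉ P := by
      by_contra hcon
      push Not at hcon
      exact hPA (hP.antisymm hcon)
    obtain ⟨p⟩ := h.preconnected ⟨a, hP ha⟩ ⟨b, hb⟩
    obtain ⟨d, -, h1, h2⟩ := p.exists_boundary_dart {x | x.1 ∈ P} ha hbP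
    refine ⟨d.fst.1, h1, d.snd.1, ?_, d.adj⟩
    rw [Finset.mem_sdiff]
    exact ⟨d.snd.2, h2⟩

lemma conn_sdiff {A Z : Finset V} (h : TwoConnectedOn R A) (hZ : Z.card ≤ 1) : Conn R (A \ Z) := by
  rcases Finset.eq_empty_or_nonempty (A ∩ Z) with h1 | ⟨v, hv⟩
  · rw [Finset.sdiff_eq_self_of_disjoint (Finset.disjoint_iff_inter_eq_empty.2 h1)]
    exact conn_of_induce h.2.1
  · rw [Finset.mem_inter] at hv
    have : Z = {v} := (Finset.eq_singleton_iff_unique_mem.2 ⟨hv.2, fun x hx => Finset.card_le_one.1 hZ x hx v hv.2⟩)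
    rw [this, Finset.sdiff_singleton_eq_erase]
    exact conn_of_induce (h.2.2 v hv.1)

lemma core_cut {ι : Type*} [DecidableEq ι] (Vp bn : ι → Finset V)
    (hbn : ∀ i, ∀ w ∈ bn i, 2 ≤ (nb R (Vp i) w).card)
    (hV : ∀ i (Z : Finset V), Z.card ≤ 1 → Conn R (Vp i \ Z)) (U0 : Finset V) (I0 : Finset ι) (hI0 : I0.Nonempty)
    (h0 : U0.card + I0.card ≤ ∑ i ∈ I0, (U0 ∩ bn i).card) :
    ∃ X i j, i ≠ j ∧ Vp i ⊆ X ∧ Vp j ⊆ X ∧ ∀ Z : Finset V, Z.card ≤ 1 → Conn R (X \ Z) := by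
  classical
  have hex : ∃ n, ∃ (U : Finset V) (I : Finset ι), I.Nonempty ∧ U.card + I.card ≤ ∑ i ∈ I, (U ∩ bn i).card ∧
    U.card + I.card = n := ⟨_, U0, I0, hI0, h0, rfl⟩
  obtain ⟨U, I, hI, hUI, hn⟩ := Nat.find_spec hex
  have hmin : ∀ (U' : Finset V) (I' : Finset ι), U'.card + I'.card < U.card + I.card →
      0 < U'.card + I'.card → ∑ i ∈ I', (U' ∩ bn i).card + 1 ≤ U'.card + I'.card := by
    intro U' I' hlt hpos
    by_cases hI' : I'.Nonempty
    · by_contra hcon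
      exact Nat.find_min hex (hn ▸ hlt) ⟨U', I', hI', by omega, rfl⟩
    · rw [Finset.not_nonempty_iff_eq_empty] at hI'
      subst hI'
      simp at hpos ⊢; exact hpos
  have hI2 : 1 < I.card := by
    by_contra hcon
    obtain ⟨i, rfl⟩ := Finset.card_eq_one.1 (show I.card = 1 by have := Finset.card_pos.2 hI; omega)
    simp at hUI
    have := Finset.card_le_card (Finset.inter_subset_left (s₁ := U) (s₂ := bn i))
    omega
  obtain ⟨i, hi, j, hj, hij⟩ := Finset.one_lt_card.1 hI2
  have hVX : ∀ i ∈ I, Vp i ⊆ U ∪ I.biUnion Vp := fun i hi =>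
    (Finset.subset_biUnion_of_mem Vp hi).trans Finset.subset_union_right
  refine ⟨U ∪ I.biUnion Vp, i, j, hij, hVX i hi, hVX j hj, fun Z hZ => ⟨?_, ?_⟩⟩
  · obtain ⟨x, hx⟩ := (hV i Z hZ).1
    rw [Finset.mem_sdiff] at hx
    exact ⟨x, by rw [Finset.mem_sdiff]; exact ⟨hVX i hi hx.1, hx.2⟩⟩
  intro P hP hPn hPX
  by_contra hno
  push Not at hno
  obtain ⟨b, hb, hbP⟩ : ∃ b ∈ (U ∪ I.biUnion Vp) \ Z, b ∉ P := by
    by_contra hcon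
    push Not at hcon
    exact hPX (hP.antisymm hcon)
  obtain ⟨a, ha⟩ := hPn
  -- each part lies on one side
  have hside : ∀ i ∈ I, ∀ x ∈ Vp i, x ∉ Z → x ∈ P → ∀ y ∈ Vp i, y ∉ Z → y ∈ P := by
    intro i hi x hx hxZ hxP y hy hyZ
    by_contra hyP
    obtain ⟨a, ha, b, hb, hab⟩ := (hV i Z hZ).2 ((Vp i \ Z) ∩ P) Finset.inter_subset_left
      ⟨x, by simp [*]⟩ (fun h => hyP (by
        have : y ∈ Vp i \ Z := by simp [*]
        rw [← h] at this; exact (Finset.mem_inter.1 this).2))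
    rw [Finset.mem_inter] at ha
    simp only [Finset.mem_sdiff, Finset.mem_inter, not_and] at hb
    refine hno a ha.2 b ?_ hab
    rw [Finset.mem_sdiff, Finset.mem_sdiff]
    exact ⟨⟨hVX i hi hb.1.1, hb.1.2⟩, hb.2 hb.1⟩
  set IP := I.filter (fun i => Vp i \ Z ⊆ P) with hIP
  set IQ := I.filter (fun i => ¬ Vp i \ Z ⊆ P) with hIQ
  set UP := U.filter (fun w => w ∈ P ∨ w ∈ Z) with hUP
  set UQ := U.filter (fun w => w ∉ P ∨ w ∈ Z) with hUQ
  have hsumI : IP.card + IQ.card = I.card := Finset.card_filter_add_card_filter_not _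
  have hsumU : UP.card + UQ.card ≤ U.card + 1 := by
    rw [← Finset.card_union_add_card_inter]
    have h1 : (UP ∪ UQ) ⊆ U := Finset.union_subset (Finset.filter_subset _ _) (Finset.filter_subset _ _)
    have h2 : (UP ∩ UQ) ⊆ Z := by
      intro w hw
      simp only [hUP, hUQ, Finset.mem_inter, Finset.mem_filter] at hw
      tauto
    have := Finset.card_le_card h1
    have := Finset.card_le_card h2
    omega
  have hUPc : UP.card ≤ U.card := Finset.card_filter_le _ _
  have hUQc : UQ.card ≤ U.card := Finset.card_filter_le _ _
  have key : ∀ (i w : _), w ∈ bn i → ∃ x ∈ Vp i, x ∉ Z ∧ R.Adj w x := by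
    intro i w hw
    have h1 := hbn i w hw
    obtain ⟨x, hx, hxZ⟩ : ∃ x ∈ nb R (Vp i) w, x ∉ Z := by
      by_contra hcon
      push Not at hcon
      have := Finset.card_le_card (show nb R (Vp i) w ⊆ Z from hcon)
      omega
    rw [mem_nb] at hx
    exact ⟨x, hx.1, hxZ, hx.2⟩
  have heP : ∀ i ∈ IP, (U ∩ bn i).card ≤ (UP ∩ bn i).card := by
    intro i hi
    rw [hIP, Finset.mem_filter] at hi
    apply Finset.card_le_card
    intro w hw
    rw [Finset.mem_inter] at hw ⊢
    refine ⟨?_, hw.2⟩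
    rw [hUP, Finset.mem_filter]
    refine ⟨hw.1, ?_⟩
    by_contra hcon
    push Not at hcon
    obtain ⟨x, hx, hxZ, hwx⟩ := key i w hw.2
    refine hno x (hi.2 (by simp [hx, hxZ])) w ?_ hwx.symm
    rw [Finset.mem_sdiff, Finset.mem_sdiff, Finset.mem_union]
    exact ⟨⟨Or.inl hw.1, hcon.2⟩, hcon.1⟩
  have hnotP : ∀ i ∈ IQ, ∀ x ∈ Vp i, x ∉ Z → x ∉ P := by
    intro i hi x hx hxZ hxP
    rw [hIQ, Finset.mem_filter] at hi
    refine hi.2 fun y hy => ?_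
    rw [Finset.mem_sdiff] at hy
    exact hside i hi.1 x hx hxZ hxP y hy.1 hy.2
  have heQ : ∀ i ∈ IQ, (U ∩ bn i).card ≤ (UQ ∩ bn i).card := by
    intro i hi
    apply Finset.card_le_card
    intro w hw
    rw [Finset.mem_inter] at hw ⊢
    refine ⟨?_, hw.2⟩
    rw [hUQ, Finset.mem_filter]
    refine ⟨hw.1, ?_⟩
    by_contra hcon
    push Not at hcon
    obtain ⟨x, hx, hxZ, hwx⟩ := key i w hw.2
    refine hno w hcon.1 x ?_ hwx
    rw [Finset.mem_sdiff, Finset.mem_sdiff]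
    exact ⟨⟨hVX i (Finset.mem_filter.1 hi).1 hx, hxZ⟩, hnotP i hi x hx hxZ⟩
  have hsum : ∑ i ∈ I, (U ∩ bn i).card ≤ ∑ i ∈ IP, (UP ∩ bn i).card + ∑ i ∈ IQ, (UQ ∩ bn i).card := by
    rw [← Finset.sum_filter_add_sum_filter_not I (fun i => Vp i \ Z ⊆ P)]
    exact add_le_add (Finset.sum_le_sum heP) (Finset.sum_le_sum heQ)
  -- strictness
  have hsP : (UQ.card < U.card ∨ IQ.card < I.card) ∧ 0 < UP.card + IP.card := by
    have haX := hP ha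
    rw [Finset.mem_sdiff, Finset.mem_union, Finset.mem_biUnion] at haX
    rcases haX.1 with h | ⟨i, hi, h⟩
    · have h1 : a ∈ UP := by rw [hUP, Finset.mem_filter]; exact ⟨h, Or.inl ha⟩
      refine ⟨Or.inl (Finset.card_lt_card (Finset.filter_ssubset.2 ⟨a, h, ?_⟩)), ?_⟩
      · have := haX.2; tauto
      · have := Finset.card_pos.2 ⟨a, h1⟩; omega
    · have hs : Vp i \ Z ⊆ P := by
        intro y hy
        rw [Finset.mem_sdiff] at hy
        exact hside i hi a h haX.2 ha y hy.1 hy.2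
      have h1 : i ∈ IP := by rw [hIP, Finset.mem_filter]; exact ⟨hi, hs⟩
      have := Finset.card_pos.2 ⟨i, h1⟩
      exact ⟨Or.inr (by omega), by omega⟩
  have hsQ : (UP.card < U.card ∨ IP.card < I.card) ∧ 0 < UQ.card + IQ.card := by
    rw [Finset.mem_sdiff, Finset.mem_union, Finset.mem_biUnion] at hb
    rcases hb.1 with h | ⟨i, hi, h⟩
    · have h1 : b ∈ UQ := by rw [hUQ, Finset.mem_filter]; exact ⟨h, Or.inl hbP⟩
      refine ⟨Or.inl (Finset.card_lt_card (Finset.filter_ssubset.2 ⟨b, h, ?_⟩)), ?_⟩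
      · have := hb.2; tauto
      · have := Finset.card_pos.2 ⟨b, h1⟩; omega
    · have hs : ¬ Vp i \ Z ⊆ P := fun hh => hbP (hh (Finset.mem_sdiff.2 ⟨h, hb.2⟩))
      have h1 : i ∈ IQ := by rw [hIQ, Finset.mem_filter]; exact ⟨hi, hs⟩
      have := Finset.card_pos.2 ⟨i, h1⟩
      exact ⟨Or.inr (by omega), by omega⟩
  have m1 := hmin UP IP (by omega) hsP.2
  have m2 := hmin UQ IQ (by omega) hsQ.2
  omega

end Part10

theorem stmt13 (V : Type*) [Fintype V] [DecidableEq V]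
    (R : SimpleGraph V) [DecidableRel R.Adj]
    (s t k : ℕ) (hs : 2 ≤ s) (ht : 2 ≤ t) (hk : 3 ≤ k)
    (hks : k ≤ s) (hstk : s ≤ t + k)
    (W : Finset V) (Vp : Fin s → Finset V)
    (hWcard : W.card ≤ s - 1)
    (hdisjWV : ∀ i, Disjoint W (Vp i))
    (hdisjVV : ∀ i j, i ≠ j → Disjoint (Vp i) (Vp j))
    (hcover : ∀ v : V, v ∈ W ∨ ∃ i, v ∈ Vp i)
    (hnoedge : ∀ i j, i ≠ j → ∀ x ∈ Vp i, ∀ y ∈ Vp j, ¬ R.Adj x y)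
    (h2conn : ∀ i, TwoConnectedOn R (Vp i))
    (m : ℕ) (hmEven : Even m) (hm : 17280000000 * (t + k) ^ 9 ≤ m)
    (hnoCm : ¬ HasCycleLen R m)
    (hcardV : Fintype.card V ≤ (t + k) * m)
    (hdeg : m + 24000000 * (t + k) ^ 5 + 2 * s < 2 * R.minDegree) :
    ∑ i, (Vp i ∪ bigNbrSet R s W (Vp i)).card ≤ Fintype.card V + s - 1 := by

  by_contra hcon
  obtain ⟨N, hNdef⟩ : ∃ N, N = t + k := ⟨_, rfl⟩
  rw [← hNdef] at hm hcardV hdeg hstk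
  have hN : 5 ≤ N := by omega
  have p3 : 25 * N ≤ N ^ 3 := by
    calc 25 * N = 5 * 5 * N := by ring
      _ ≤ N * N * N := by gcongr
      _ = N ^ 3 := by ring
  have p4 : 5 * N ^ 3 ≤ N ^ 4 := by
    calc 5 * N ^ 3 ≤ N * N ^ 3 := by gcongr
      _ = N ^ 4 := by ring
  have p5 : 5 * N ^ 4 ≤ N ^ 5 := by
    calc 5 * N ^ 4 ≤ N * N ^ 4 := by gcongr
      _ = N ^ 5 := by ring
  obtain ⟨D, hD⟩ : ∃ D, D + s = R.minDegree := ⟨R.minDegree - s, by omega⟩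
  have hDm : m + 24000000 * N ^ 5 < 2 * D := by omega
  obtain ⟨d, hd⟩ : ∃ d, d + 40000 * N ^ 4 = D := ⟨D - 40000 * N ^ 4, by omega⟩
  have hDdeg : ∀ v, D + s ≤ R.degree v := fun v => hD ▸ R.minDegree_le_degree v
  have hfin : ¬ ∃ l, Cyc R l ∧ Even l.length ∧ 2 * d ≤ l.length + 14000 * N ^ 3 := by
    rintro ⟨l, h1, h2, h3⟩
    refine hnoCm (partA (N := N) (by omega) (fun v => ?_) hcardV hm hmEven h1 ?_ h2)
    · have := hDdeg v; omega
    · have : 420 * N ^ 2 * (210 * N ^ 2) = 88200 * N ^ 4 := by ring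
      omega
  have hcard : ∀ Q : Finset V, Q.card ≤ 4 * N * d := by
    intro Q
    calc Q.card ≤ Fintype.card V := Finset.card_le_univ Q
      _ ≤ N * m := hcardV
      _ ≤ N * (4 * d) := by gcongr; omega
      _ = 4 * N * d := by ring
  have hMD : ∀ i, MD R (Vp i) D := by
    intro i v hv
    have h1 : R.neighborFinset v ⊆ nb R (Vp i) v ∪ W := by
      intro w hw
      rw [SimpleGraph.mem_neighborFinset] at hw
      rw [Finset.mem_union, mem_nb]
      rcases hcover w with h | ⟨j, hj⟩
      · exact Or.inr h
      · by_cases hij : i = j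
        · subst hij; exact Or.inl ⟨hj, hw⟩
        · exact absurd hw (hnoedge i j hij v hv w hj)
    have h2 := (Finset.card_le_card h1).trans (Finset.card_union_le _ _)
    rw [SimpleGraph.card_neighborFinset_eq_degree] at h2
    have := hDdeg v
    omega
  have hdN : 14000 * N ^ 3 < d := by omega
  have hMDc : ∀ Q : Finset V, Q.Nonempty → MD R Q (d + 75 * N) → 2 ≤ Q.card := by
    rintro Q ⟨x, hx⟩ hQ
    have h1 := hQ x hx
    have h2 := Finset.card_le_card (show nb R Q x ⊆ Q from Finset.filter_subset _ _)
    omega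
  have hbip : ∀ Q : Finset V, MD R Q (d + 100 * N) → KC R (8000 * N ^ 3) Q →
      ∀ B : Finset V, B.card ≤ 100 * N → ¬ TwoCol R (Q \ B) :=
    fun Q h1 h2 B hB hc => hfin (bip_cyc hN h1 (hcard Q) hdN h2 hB hc)
  have hglue : ∀ X Q1 Q2 : Finset V, (∀ Z : Finset V, Z.card ≤ 1 → Conn R (X \ Z)) → Q1 ⊆ X → Q2 ⊆ X →
      Disjoint Q1 Q2 → Q1.Nonempty → Q2.Nonempty → MD R Q1 (d + 100 * N) → MD R Q2 (d + 100 * N) →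
      KC R (8000 * N ^ 3) Q1 → KC R (8000 * N ^ 3) Q2 → False := by
    intro X Q1 Q2 hX h1 h2 hdis n1 n2 d1 d2 k1 k2
    have d1' : MD R Q1 (d + 75 * N) := d1.mono (by omega)
    have d2' : MD R Q2 (d + 75 * N) := d2.mono (by omega)
    refine hfin (glue (by simpa using hX ∅ (by simp)) (fun z => ?_) h1 h2 hdis hN d1' d2' (hcard _) (hcard _) hdN k1 k2
      (hbip Q1 d1 k1) (hMDc _ n1 d1') (hMDc _ n2 d2'))
    have := hX {z} (by simp)
    rwa [Finset.sdiff_singleton_eq_erase] at this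
  have hne : ∀ i, (Vp i).Nonempty := fun i => Finset.card_pos.1 (by have := (h2conn i).1; omega)
  by_cases hKC : ∀ i, KC R (8000 * N ^ 3) (Vp i)
  swap
  · push Not at hKC
    obtain ⟨i, hi⟩ := hKC
    have e1 : 2 * ((4 * N + 1) * (8000 * N ^ 3)) = 64000 * N ^ 4 + 16000 * N ^ 3 := by ring
    have e2 : 4 * N * (8000 * N ^ 3) = 32000 * N ^ 4 := by ring
    obtain ⟨Q1, Q2, a1, a2, b, n1, n2, c1, c2, f1, f2⟩ := two_pieces (R := R) (D := D) (κ := 8000 * N ^ 3)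
      (n := Fintype.card V) (N := N) (Q := Vp i) (by
        calc Fintype.card V ≤ N * m := hcardV
          _ ≤ N * (2 * D) := by gcongr; omega
          _ = 2 * N * D := by ring) (by rw [e1]; omega) (Finset.card_le_univ _) (hMD i) (hne i) hi
    rw [e2] at c1 c2
    exact hglue (Vp i) Q1 Q2 (fun Z hZ => conn_sdiff (h2conn i) hZ) a1 a2 b n1 n2 (c1.mono (by omega))
      (c2.mono (by omega)) f1 f2
  · have hsum : W.card + (Finset.univ : Finset (Fin s)).card ≤
        ∑ i ∈ (Finset.univ : Finset (Fin s)), (W ∩ bigNbrSet R s W (Vp i)).card := by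
      have h1 : ∀ i, (Vp i ∪ bigNbrSet R s W (Vp i)).card = (Vp i).card + (W ∩ bigNbrSet R s W (Vp i)).card := by
        intro i
        have hsub : bigNbrSet R s W (Vp i) ⊆ W := Finset.filter_subset _ _
        rw [Finset.inter_eq_right.2 hsub, Finset.card_union_of_disjoint]
        exact (Disjoint.mono_left hsub (hdisjWV i)).symm
      have h2 : Fintype.card V = W.card + ∑ i, (Vp i).card := by
        rw [← Finset.card_biUnion (fun i _ j _ hij => hdisjVV i j hij), ← Finset.card_union_of_disjoint,
          ← Finset.card_univ]
        · congr 1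
          ext v
          simpa using hcover v
        · rw [Finset.disjoint_biUnion_right]
          exact fun i _ => hdisjWV i
      simp only [h1, Finset.sum_add_distrib] at hcon
      rw [Finset.card_univ, Fintype.card_fin]
      omega
    obtain ⟨X, i, j, hij, hiX, hjX, hX⟩ := core_cut (R := R) Vp (fun i => bigNbrSet R s W (Vp i)) (by
      intro i w hw
      have := (Finset.mem_filter.1 hw).2
      have h2 : (nb R (Vp i) w).card = ((Vp i).filter fun v => R.Adj w v).card := rfl
      omega) (fun i Z hZ => conn_sdiff (h2conn i) hZ) W Finset.univ ⟨⟨0, by omega⟩, Finset.mem_univ _⟩ hsum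
    exact hglue X (Vp i) (Vp j) hX hiX hjX (hdisjVV i j hij) (hne i) (hne j) ((hMD i).mono (by omega))
      ((hMD j).mono (by omega)) (hKC i) (hKC j)
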